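/- Let (R,𝔪) be a complete Noetherian local ring and M a finitely generated R-module of dimension d. For every subset T of Assh M there exists an ideal 𝔞 of R such that Att H^d_𝔞(M) = T. -/

import Mathlib

noncomputable section
open CategoryTheory

namespace Paper

variable (R : Type) [CommRing R]

/-- The `i`-th local cohomology of the `R`-module `M` with respect to the ideal `I`. -/
abbrev H (I : Ideal R) (i : ℕ) (M : Type) [AddCommGroup M] [Module R M] : ModuleCat R :=
  (localCohomology I i).obj (ModuleCat.of R M)

/-- `N` is a `p`-secondary submodule of `M`: it is nonzero, every `r : R` acts on it either
surjectively or nilpotently, and `p` is the radical of its annihilator. -/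
def IsSecondaryFor {M : Type} [AddCommGroup M] [Module R M]
    (N : Submodule R M) (p : Ideal R) : Prop :=
  N ≠ ⊥ ∧
  (∀ r : R, (∀ m ∈ N, ∃ n ∈ N, r • n = m) ∨ (∃ k : ℕ, ∀ m ∈ N, r ^ k • m = 0)) ∧
  N.annihilator.radical = p

/-- A minimal secondary representation of the module `M`. -/
structure MinSecRep (M : Type) [AddCommGroup M] [Module R M] where
  n : ℕ
  S : Fin n → Submodule R M
  p : Fin n → Ideal R
  prime : ∀ i, (p i).IsPrime
  sec : ∀ i, IsSecondaryFor R (S i) (p i)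
  sum : (⨆ i, S i) = ⊤
  inj : Function.Injective p
  irred : ∀ j, ¬ (S j ≤ ⨆ i ∈ ({j}ᶜ : Set (Fin n)), S i)

/-- `M` is representable: it is a (finite) sum of secondary submodules. -/
def IsRepresentable (M : Type) [AddCommGroup M] [Module R M] : Prop :=
  ∃ (n : ℕ) (S : Fin n → Submodule R M) (p : Fin n → Ideal R),
    (∀ i, (p i).IsPrime) ∧ (∀ i, IsSecondaryFor R (S i) (p i)) ∧ (⨆ i, S i) = ⊤

/-- The set of attached primes of `M`: the primes occurring in a minimal secondary
representation of `M`. -/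
def attached (M : Type) [AddCommGroup M] [Module R M] : Set (Ideal R) :=
  {q | ∃ (rep : MinSecRep R M) (i : Fin rep.n), rep.p i = q}

/-- The coheight (dimension of `R/I`): Krull dimension of the set of primes containing `I`. -/
def coheight (I : Ideal R) : WithBot ℕ∞ :=
  Order.krullDim {p : Ideal R // p.IsPrime ∧ I ≤ p}

/-- The Krull dimension of the ring `R`. -/
def ringDim : WithBot ℕ∞ := Order.krullDim {p : Ideal R // p.IsPrime}

/-- The Krull dimension of (the support of) the finitely generated module `M`. -/
def dimMod (M : Type) [AddCommGroup M] [Module R M] : WithBot ℕ∞ :=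
  coheight R (Module.annihilator R M)

/-- The dimension of the localized module `M_q`: chains of primes in the support of `M`
contained in `q`. -/
def dimModAt (M : Type) [AddCommGroup M] [Module R M] (q : Ideal R) : WithBot ℕ∞ :=
  Order.krullDim {p : Ideal R // p.IsPrime ∧ Module.annihilator R M ≤ p ∧ p ≤ q}

/-- The support of a finitely generated module: primes containing the annihilator. -/
def supp (M : Type) [AddCommGroup M] [Module R M] : Set (Ideal R) :=
  {p | p.IsPrime ∧ Module.annihilator R M ≤ p}

/-- `Min M`: minimal primes of the support of `M`. -/
def minSupp (M : Type) [AddCommGroup M] [Module R M] : Set (Ideal R) :=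
  (Module.annihilator R M).minimalPrimes

/-- `Assh M`: primes in the support of maximal coheight. -/
def assh (M : Type) [AddCommGroup M] [Module R M] : Set (Ideal R) :=
  {p | p ∈ supp R M ∧ coheight R p = dimMod R M}

open RingTheory.Sequence in
/-- Depth of `M` with respect to the ideal `J`: supremum of the lengths of `M`-regular
sequences contained in `J`. -/
def depthOn (J : Ideal R) (M : Type) [AddCommGroup M] [Module R M] : ℕ∞ :=
  ⨆ l ∈ {l : List R | (∀ x ∈ l, x ∈ J) ∧ IsRegular M l}, (l.length : ℕ∞)

/-- `M` is a Cohen–Macaulay module over the local ring `R`: depth = dimension. -/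
def IsCMLocalMod [IsLocalRing R] (M : Type) [AddCommGroup M] [Module R M] : Prop :=
  (depthOn R (IsLocalRing.maximalIdeal R) M : WithBot ℕ∞) = dimMod R M

/-- `R` is a Cohen–Macaulay local ring: it is local and its depth (w.r.t. its Jacobson
radical, which is the maximal ideal) equals its Krull dimension. -/
def IsCMLocalRing : Prop :=
  IsLocalRing R ∧ ((depthOn R ((⊥ : Ideal R).jacobson) R : WithBot ℕ∞) = ringDim R)

/-- `R` is a Cohen–Macaulay ring: all of its localizations at primes are CM local rings. -/
def IsCMRing : Prop :=
  ∀ (p : Ideal R) [p.IsPrime], IsCMLocalRing (Localization.AtPrime p)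

/-- `M` is an equidimensional module: every minimal prime of its support has coheight equal
to the dimension of `M`. -/
def IsEquidim (M : Type) [AddCommGroup M] [Module R M] : Prop :=
  ∀ q ∈ minSupp R M, coheight R q = dimMod R M

/-- `R` is catenary: any two saturated chains of primes with the same endpoints have the
same length. -/
def IsCatenary : Prop :=
  ∀ (c₁ c₂ : LTSeries {p : Ideal R // p.IsPrime}),
    c₁.head = c₂.head → c₁.last = c₂.last →
    (∀ i : Fin c₁.length, c₁.toFun i.castSucc ⋖ c₁.toFun i.succ) →
    (∀ i : Fin c₂.length, c₂.toFun i.castSucc ⋖ c₂.toFun i.succ) →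
    c₁.length = c₂.length

/-- `R` is universally catenary: every finitely generated `R`-algebra is catenary. -/
def IsUnivCatenary : Prop :=
  ∀ (A : Type) [CommRing A] [Algebra R A], Algebra.FiniteType R A → IsCatenary A

/-- `x` is a uniform local cohomological annihilator of `M`: `x` avoids all minimal primes
of `M` and, for every maximal ideal `m`, kills `H^i_m(M)` for all `i < dim M_m`. -/
def IsULCA (M : Type) [AddCommGroup M] [Module R M] (x : R) : Prop :=
  (∀ p ∈ minSupp R M, x ∉ p) ∧
  ∀ (m : Ideal R), m.IsMaximal → ∀ i : ℕ, (i : WithBot ℕ∞) < dimModAt R M m →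
    ∀ y : H R m i M, x • y = 0

/-- `M` has a uniform local cohomological annihilator. -/
def HasULCA (M : Type) [AddCommGroup M] [Module R M] : Prop := ∃ x, IsULCA R M x

/-- `R/p` has a uniform local cohomological annihilator (local case): some `x ∉ p` kills
`H^i_𝔪(R/p)` for all `i < dim R/p`. -/
def HasULCAQuot [IsLocalRing R] (p : Ideal R) : Prop :=
  ∃ x ∉ p, ∀ i : ℕ, (i : WithBot ℕ∞) < coheight R p →
    ∀ y : H R (IsLocalRing.maximalIdeal R) i (R ⧸ p), x • y = 0

/-- `M` is generalized Cohen–Macaulay over the local ring `R`: a power of the maximal ideal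
kills all local cohomology below the dimension. -/
def IsGCM [IsLocalRing R] (M : Type) [AddCommGroup M] [Module R M] : Prop :=
  ∃ n : ℕ, ∀ i : ℕ, (i : WithBot ℕ∞) < dimMod R M →
    ∀ a ∈ (IsLocalRing.maximalIdeal R) ^ n,
      ∀ y : H R (IsLocalRing.maximalIdeal R) i M, a • y = 0

end Paper

namespace LC

section

open CategoryTheory Limits Opposite

variable {R : Type} [CommRing R]

/-- The functor `Hom(-, Y)` with values in the opposite category. -/
abbrev homF (Y : ModuleCat.{0} R) : ModuleCat.{0} R ⥤ (ModuleCat.{0} R)ᵒᵖ :=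
  ((linearYoneda R (ModuleCat.{0} R)).obj Y).rightOp

/-- The complex of homomorphisms from a projective resolution to `Y`. -/
abbrev homCx {X : ModuleCat.{0} R} (P : ProjectiveResolution X) (Y : ModuleCat.{0} R) :=
  ((homF Y).mapHomologicalComplex (ComplexShape.down ℕ)).obj P.complex

/-- `Ext` as a derived functor, the version entering the definition of local cohomology. -/
abbrev oldExt (X Y : ModuleCat.{0} R) (n : ℕ) : ModuleCat.{0} R :=
  ((Ext R (ModuleCat.{0} R) n).obj (op X)).obj Y

/-- The module of `n`-cocycles of the complex of homomorphisms. -/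
def cocyc {X : ModuleCat.{0} R} (P : ProjectiveResolution X) (Y : ModuleCat.{0} R) (n : ℕ) :
    ModuleCat R := ((homCx P Y).opcycles n).unop

/-- The module of homomorphisms as an object. -/
abbrev homMod (X Y : ModuleCat.{0} R) : ModuleCat.{0} R := ModuleCat.of R (X ⟶ Y)

/-- The inclusion of cocycles into homomorphisms. -/
def cocycι {X : ModuleCat.{0} R} (P : ProjectiveResolution X) (Y : ModuleCat.{0} R) (n : ℕ) :
    cocyc P Y n ⟶ homMod (P.complex.X n) Y := ((homCx P Y).pOpcycles n).unop

/-- The derived functor computed by a projective resolution. -/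
def hIso {X : ModuleCat.{0} R} (P : ProjectiveResolution X) (Y : ModuleCat.{0} R) (n : ℕ) :
    ((homF Y).leftDerived n).obj X ≅ (homCx P Y).homology n :=
  P.isoLeftDerivedObj (homF Y) n

/-- The projection of cocycles onto `Ext`. -/
def cocycπ {X : ModuleCat.{0} R} (P : ProjectiveResolution X) (Y : ModuleCat.{0} R) (n : ℕ) :
    cocyc P Y n ⟶ oldExt X Y n :=
  ((hIso P Y n).hom ≫ (homCx P Y).homologyι n).unop

variable {X Y : ModuleCat.{0} R} (P : ProjectiveResolution X) (n : ℕ)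

instance : Mono (cocycι P Y n) := by
  have : Epi ((homCx P Y).pOpcycles n) := inferInstance
  exact @unop_mono_of_epi _ _ _ _ _ this

instance : Epi (cocycπ P Y n) := by
  have h1 : Mono ((homCx P Y).homologyι n) := inferInstance
  have : Mono ((hIso P Y n).hom ≫ (homCx P Y).homologyι n) :=
    inferInstance
  exact @unop_epi_of_mono _ _ _ _ _ this

lemma cocycι_d (c : cocyc P Y n) (m : ℕ) : P.complex.d m n ≫ cocycι P Y n c = 0 := by
  have h := (homCx P Y).d_pOpcycles m n
  have h2 := congrArg Quiver.Hom.unop h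
  have := ConcreteCategory.congr_hom h2 c
  exact this

lemma exists_cocyc (f : P.complex.X n ⟶ Y) (hf : P.complex.d (n+1) n ≫ f = 0) :
    ∃ c : cocyc P Y n, cocycι P Y n c = f := by
  have h1 := (homCx P Y).opcyclesIsCokernel (n+1) n (by simp)
  have h2 : (ShortComplex.mk _ _ ((homCx P Y).d_pOpcycles (n+1) n)).Exact :=
    ShortComplex.exact_of_g_is_cokernel _ h1
  have h3 := h2.unop
  rw [ShortComplex.moduleCat_exact_iff] at h3
  exact h3 f hf

lemma cocycπ_eq_zero_iff (p : ℕ) (hp : p + 1 = n) (c : cocyc P Y n) :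
    cocycπ P Y n c = 0 ↔ ∃ g : P.complex.X p ⟶ Y, P.complex.d n p ≫ g = cocycι P Y n c := by
  subst hp
  have h1 := (homCx P Y).homologyIsKernel (p+1) p (by simp)
  have h2 : (ShortComplex.mk _ _ ((homCx P Y).homologyι_comp_fromOpcycles (p+1) p)).Exact :=
    ShortComplex.exact_of_f_is_kernel _ h1
  have h3 := h2.unop
  rw [ShortComplex.moduleCat_exact_iff] at h3
  have h4 : ∀ g : P.complex.X p ⟶ Y, cocycι P Y (p+1) (((homCx P Y).fromOpcycles (p+1) p).unop g)
      = P.complex.d (p+1) p ≫ g := by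
    intro g
    have := congrArg Quiver.Hom.unop ((homCx P Y).p_fromOpcycles (p+1) p)
    exact ConcreteCategory.congr_hom this g
  have h5 : ∀ c, cocycπ P Y (p+1) c =
    (hIso P Y (p+1)).hom.unop (((homCx P Y).homologyι (p+1)).unop c) :=
    fun c => rfl
  constructor
  · intro h
    have h6 : ((homCx P Y).homologyι (p+1)).unop c = 0 := by
      have hinj : Function.Injective (hIso P Y (p+1)).hom.unop :=
        (ModuleCat.mono_iff_injective _).1 inferInstance
      apply hinj
      exact ((h5 c).symm.trans h).trans (map_zero _).symm
    obtain ⟨g, hg⟩ := h3 c h6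
    refine ⟨g, ?_⟩
    exact (h4 g).symm.trans (congrArg _ hg)
  · rintro ⟨g, hg⟩
    rw [← h4] at hg
    have hinj : Function.Injective (cocycι P Y (p+1)) :=
        (ModuleCat.mono_iff_injective _).1 inferInstance
    have := hinj hg
    rw [h5, ← this]
    have := congrArg Quiver.Hom.unop ((homCx P Y).homologyι_comp_fromOpcycles (p+1) p)
    have := ConcreteCategory.congr_hom this g
    refine (congrArg _ this).trans (map_zero _)

lemma cocycπ_zero_injective (c : cocyc P Y 0) (hc : cocycπ P Y 0 c = 0) : c = 0 := by
  have h1 : IsIso ((homCx P Y).homologyι 0) := inferInstance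
  have h2 : Mono (cocycπ P Y 0) := by
    have : Epi ((hIso P Y 0).hom ≫ (homCx P Y).homologyι 0) :=
      inferInstance
    exact @unop_mono_of_epi _ _ _ _ _ this
  have h3 : Function.Injective (cocycπ P Y 0) := (ModuleCat.mono_iff_injective _).1 h2
  exact h3 (hc.trans (map_zero _).symm)

lemma cocycι_injective : Function.Injective (cocycι P Y n) :=
  (ModuleCat.mono_iff_injective _).1 inferInstance

lemma cocycπ_surjective : Function.Surjective (cocycπ P Y n) :=
  (ModuleCat.epi_iff_surjective _).1 inferInstance

lemma extMk_zero_eq_zero (f : P.complex.X 0 ⟶ Y) (hf : P.complex.d 1 0 ≫ f = 0)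
    (h : P.extMk f 1 rfl hf = 0) : f = 0 := by
  rw [← P.extEquivCohomologyClass.apply_eq_iff_eq,
    P.extEquivCohomologyClass_extMk, P.extEquivCohomologyClass_zero,
    CochainComplex.HomComplex.CohomologyClass.mk_eq_zero_iff,
    CochainComplex.HomComplex.Cocycle.toSingleMk_mem_coboundaries_iff _ _ _ _ _ 1 (by lia)] at h
  obtain ⟨g, hg⟩ := h
  have : P.cochainComplex.d (-(0:ℕ):ℤ) 1 = 0 := by
    apply IsZero.eq_of_tgt
    exact CochainComplex.isZero_of_isStrictlyLE _ 0 _ (by lia)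
  rw [this, zero_comp] at hg
  rw [← cancel_epi (P.cochainComplexXIso (-(0:ℕ):ℤ) 0 rfl).hom, ← hg, comp_zero]

lemma cocycπ_eq_zero_iff_extMk (c : cocyc P Y n) :
    cocycπ P Y n c = 0 ↔ P.extMk (cocycι P Y n c) (n+1) rfl (cocycι_d P n c _) = 0 := by
  rcases n with _ | n
  · constructor
    · intro h
      obtain rfl := cocycπ_zero_injective P c h
      simp
    · intro h
      have := extMk_zero_eq_zero P _ _ h
      have : c = 0 := cocycι_injective P 0 (this.trans (map_zero _).symm)
      rw [this, map_zero]
  · rw [cocycπ_eq_zero_iff P (n+1) n rfl, P.extMk_eq_zero_iff _ _ _ _ n rfl]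

/-- The class in the derived-category `Ext` of a cocycle. -/
def cocycExt : cocyc P Y n →+ Abelian.Ext X Y n where
  toFun c := P.extMk (cocycι P Y n c) (n+1) rfl (cocycι_d P n c _)
  map_zero' := by simp
  map_add' a b := by
    rw [P.add_extMk]
    congr 1
    exact map_add _ _ _

lemma cocycExt_apply (c : cocyc P Y n) :
    cocycExt P n c = P.extMk (cocycι P Y n c) (n+1) rfl (cocycι_d P n c _) := rfl

lemma cocycExt_eq_of_cocycπ_eq {c c' : cocyc P Y n} (h : cocycπ P Y n c = cocycπ P Y n c') :
    cocycExt P n c = cocycExt P n c' := by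
  rw [← sub_eq_zero, ← map_sub]
  exact (cocycπ_eq_zero_iff_extMk P n (c - c')).1 (by rw [map_sub, h, sub_self])

lemma extMk_congr {f f' : P.complex.X n ⟶ Y} (h : f = f') (hf : P.complex.d (n+1) n ≫ f = 0)
    (hf' : P.complex.d (n+1) n ≫ f' = 0) : P.extMk f (n+1) rfl hf = P.extMk f' (n+1) rfl hf' := by
  subst h; rfl

/-- The additive comparison map from the derived-functor `Ext` to the derived-category `Ext`. -/
def cmp (X Y : ModuleCat.{0} R) (n : ℕ) : oldExt X Y n →+ Abelian.Ext X Y n :=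
  AddMonoidHom.mk' (fun e => cocycExt (projectiveResolution X) n
    (Function.surjInv (cocycπ_surjective (projectiveResolution X) n) e)) (fun a b => by
      rw [← map_add]
      apply cocycExt_eq_of_cocycπ_eq
      have h := Function.surjInv_eq (cocycπ_surjective (projectiveResolution X) (Y := Y) n)
      rw [map_add]
      exact (h _).trans (congrArg₂ (· + ·) (h a) (h b)).symm)

lemma cmp_cocycπ (c : cocyc (projectiveResolution X) Y n) :
    cmp X Y n (cocycπ _ _ _ c) = cocycExt _ n c :=
  cocycExt_eq_of_cocycπ_eq _ _ (Function.surjInv_eq _ _)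

lemma cmp_injective : Function.Injective (cmp X Y n) := by
  rw [injective_iff_map_eq_zero]
  intro e he
  obtain ⟨c, rfl⟩ := cocycπ_surjective (projectiveResolution X) n e
  rw [cmp_cocycπ] at he
  exact (cocycπ_eq_zero_iff_extMk _ n c).2 he

lemma cmp_surjective : Function.Surjective (cmp X Y n) := by
  intro a
  obtain ⟨f, hf, rfl⟩ := (projectiveResolution X).extMk_surjective a (n+1) rfl
  obtain ⟨c, rfl⟩ := exists_cocyc _ n f hf
  exact ⟨_, cmp_cocycπ n c⟩

lemma hIso_postcomp {Y' : ModuleCat.{0} R} (α : homF Y' ⟶ homF Y) :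
    (NatTrans.leftDerived α n).app X ≫ (hIso P Y n).hom = (hIso P Y' n).hom ≫
      HomologicalComplex.homologyMap
        ((NatTrans.mapHomologicalComplex α (ComplexShape.down ℕ)).app P.complex) n := by
  have h3 : (NatTrans.leftDerived α n).app X = (hIso P Y' n).hom ≫
      HomologicalComplex.homologyMap
        ((NatTrans.mapHomologicalComplex α (ComplexShape.down ℕ)).app P.complex) n ≫
      (hIso P Y n).inv := ProjectiveResolution.leftDerived_app_eq α P n
  rw [h3, Category.assoc, Category.assoc, Iso.inv_hom_id, Category.comp_id]

lemma hIso_precomp {X' : ModuleCat.{0} R} {g : X' ⟶ X} {P' : ProjectiveResolution X'}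
    (ψ : ProjectiveResolution.Hom P' P g) :
    ((homF Y).leftDerived n).map g ≫ (hIso P Y n).hom = (hIso P' Y n).hom ≫
      HomologicalComplex.homologyMap
        (((homF Y).mapHomologicalComplex (ComplexShape.down ℕ)).map ψ.hom) n :=
  ProjectiveResolution.isoLeftDerivedObj_hom_naturality g P' P ψ.hom
        ψ.hom_f_zero_comp_π_f_zero (homF Y) n

lemma cmp_postcomp {Y' : ModuleCat.{0} R} (g : Y ⟶ Y') (e : oldExt X Y n) :
    cmp X Y' n (((Ext R (ModuleCat.{0} R) n).obj (op X)).map g e) =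
      (cmp X Y n e).comp (Abelian.Ext.mk₀ g) (add_zero n) := by
  let P := projectiveResolution X
  obtain ⟨c, rfl⟩ := cocycπ_surjective P n e
  let α : homF Y' ⟶ homF Y := NatTrans.rightOp ((linearYoneda R (ModuleCat.{0} R)).map g)
  let φ := (NatTrans.mapHomologicalComplex α (ComplexShape.down ℕ)).app P.complex
  let c' : cocyc P Y' n := (HomologicalComplex.opcyclesMap φ n).unop c
  have h1 : cocycι P Y' n c' = cocycι P Y n c ≫ g := by
    have := congrArg Quiver.Hom.unop (HomologicalComplex.p_opcyclesMap φ n)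
    exact ConcreteCategory.congr_hom this c
  have h2 : ((Ext R (ModuleCat.{0} R) n).obj (op X)).map g (cocycπ P Y n c) = cocycπ P Y' n c' := by
    have h3 := hIso_postcomp P n α
    have h4 : (NatTrans.leftDerived α n).app X ≫ ((hIso P Y n).hom ≫
        (homCx P Y).homologyι n) = ((hIso P Y' n).hom ≫
        (homCx P Y').homologyι n) ≫ HomologicalComplex.opcyclesMap φ n := by
      rw [← Category.assoc, h3, Category.assoc, Category.assoc,
        HomologicalComplex.homologyι_naturality]
    exact ConcreteCategory.congr_hom (congrArg Quiver.Hom.unop h4) c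
  refine ((congrArg _ h2).trans (cmp_cocycπ n c')).trans ?_
  rw [cmp_cocycπ]
  rw [cocycExt_apply, cocycExt_apply, ProjectiveResolution.extMk_comp_mk₀]
  exact extMk_congr _ _ h1 _ _

lemma cmp_precomp {X' : ModuleCat.{0} R} (g : X' ⟶ X) (e : oldExt X Y n) :
    cmp X' Y n (((Ext R (ModuleCat.{0} R) n).map g.op).app Y e) =
      (Abelian.Ext.mk₀ g).comp (cmp X Y n e) (zero_add n) := by
  let P := projectiveResolution X
  obtain ⟨c, rfl⟩ := cocycπ_surjective P n e
  let P' := projectiveResolution X'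
  let ψ : ProjectiveResolution.Hom P' P g :=
    { hom := ProjectiveResolution.lift g P' P
      hom_f_zero_comp_π_f_zero := (ProjectiveResolution.lift_commutes_zero g P' P) }
  let φ := ((homF Y).mapHomologicalComplex (ComplexShape.down ℕ)).map ψ.hom
  let c' : cocyc P' Y n := (HomologicalComplex.opcyclesMap φ n).unop c
  have h1 : cocycι P' Y n c' = ψ.hom.f n ≫ cocycι P Y n c := by
    have := congrArg Quiver.Hom.unop (HomologicalComplex.p_opcyclesMap φ n)
    exact ConcreteCategory.congr_hom this c
  have h2 : ((Ext R (ModuleCat.{0} R) n).map g.op).app Y (cocycπ P Y n c) = cocycπ P' Y n c' := by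
    have h4 : ((homF Y).leftDerived n).map g ≫ ((hIso P Y n).hom ≫
        (homCx P Y).homologyι n) = ((hIso P' Y n).hom ≫
        (homCx P' Y).homologyι n) ≫ HomologicalComplex.opcyclesMap φ n := by
      have h3 := hIso_precomp P n (Y := Y) ψ
      rw [← Category.assoc, h3, Category.assoc, Category.assoc,
        HomologicalComplex.homologyι_naturality]
    exact ConcreteCategory.congr_hom (congrArg Quiver.Hom.unop h4) c
  refine ((congrArg _ h2).trans (cmp_cocycπ n c')).trans ?_
  rw [cmp_cocycπ]
  rw [cocycExt_apply, cocycExt_apply, ProjectiveResolution.mk₀_comp_extMk _ _ _ _ ψ]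
  exact extMk_congr _ _ h1 _ _

end

section

open CategoryTheory Limits Opposite

variable {R : Type} [CommRing R]

lemma cmp_smul {X Y : ModuleCat.{0} R} {n : ℕ} (r : R) (e : oldExt X Y n) :
    cmp X Y n (r • e) = r • cmp X Y n e := by
  obtain ⟨c, rfl⟩ := cocycπ_surjective (projectiveResolution X) n e
  rw [← map_smul, cmp_cocycπ, cmp_cocycπ, Abelian.Ext.smul_eq_comp_mk₀,
    cocycExt_apply, cocycExt_apply, ProjectiveResolution.extMk_comp_mk₀]
  refine extMk_congr _ _ ?_ _ _
  rw [map_smul]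
  change r • (cocycι (projectiveResolution X) Y n c : _ ⟶ _) = _
  rw [Linear.comp_smul, Category.comp_id]

/-- The two versions of `Ext` are linearly equivalent. -/
def cmpEquiv (X Y : ModuleCat.{0} R) (n : ℕ) : oldExt X Y n ≃ₗ[R] Abelian.Ext X Y n :=
  LinearEquiv.ofBijective { cmp X Y n with map_smul' := cmp_smul }
    ⟨cmp_injective n, cmp_surjective n⟩

/-- The quotient `R / a ^ k` as an object. -/
abbrev Q (a : Ideal R) (k : ℕ) : ModuleCat.{0} R := ModuleCat.of R (R ⧸ a ^ k)

/-- The transition map `R / a ^ l ⟶ R / a ^ k`. -/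
def tr (a : Ideal R) {k l : ℕ} (h : k ≤ l) : Q a l ⟶ Q a k :=
  ModuleCat.ofHom (Submodule.mapQ _ _ LinearMap.id (Ideal.pow_le_pow_right h))

variable (a : Ideal R) (i : ℕ) (N : Type) [AddCommGroup N] [Module R N]

/-- The diagram of modules `Ext i (R / a ^ k) N` whose colimit is local cohomology. -/
abbrev dg : (ℕᵒᵖ)ᵒᵖ ⥤ ModuleCat.{0} R :=
  localCohomology.diagram (localCohomology.idealPowersDiagram a) i ⋙
    (evaluation _ _).obj (ModuleCat.of R N)

/-- The cocone exhibiting local cohomology as a colimit. -/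
def cc : Cocone (dg a i N) :=
  ((evaluation _ _).obj (ModuleCat.of R N)).mapCocone
    (colimit.cocone (localCohomology.diagram (localCohomology.idealPowersDiagram a) i))

/-- Local cohomology is the colimit of its diagram. -/
def ccIsColimit : IsColimit (cc a i N) :=
  isColimitOfPreserves ((evaluation _ _).obj (ModuleCat.of R N)) (colimit.isColimit _)

/-- The map from `Ext i (R / a ^ k) N` to local cohomology. -/
def io (k : ℕ) : Abelian.Ext (Q a k) (ModuleCat.of R N) i →ₗ[R] Paper.H R a i N :=
  ((cc a i N).ι.app (op (op k))).hom ∘ₗ (cmpEquiv (Q a k) (ModuleCat.of R N) i).symm.toLinearMap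

lemma io_cmp (k : ℕ) (e : oldExt (Q a k) (ModuleCat.of R N) i) :
    io a i N k (cmp _ _ _ e) = (cc a i N).ι.app (op (op k)) e :=
  congrArg _ ((cmpEquiv (Q a k) (ModuleCat.of R N) i).symm_apply_apply e)

lemma io_surj (y : Paper.H R a i N) : ∃ k x, io a i N k x = y := by
  obtain ⟨j, x, hx⟩ := Concrete.isColimit_exists_rep _ (ccIsColimit a i N) y
  exact ⟨j.unop.unop, cmp _ _ _ x, (io_cmp _ _ _ _ _).trans hx⟩

variable {a i N}

lemma dg_map {k l : ℕ} (h : k ≤ l) (e : oldExt (Q a k) (ModuleCat.of R N) i) :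
    cmp _ _ _ ((dg a i N).map (homOfLE h).op.op e) =
      (Abelian.Ext.mk₀ (tr a h)).comp (cmp _ _ _ e) (zero_add i) :=
  cmp_precomp i (tr a h) e

lemma io_tr {k l : ℕ} (h : k ≤ l) (x : Abelian.Ext (Q a k) (ModuleCat.of R N) i) :
    io a i N l ((Abelian.Ext.mk₀ (tr a h)).comp x (zero_add i)) = io a i N k x := by
  obtain ⟨e, rfl⟩ := cmp_surjective i x
  rw [← dg_map, io_cmp]
  refine (io_cmp a i N l _).trans ?_
  exact ConcreteCategory.congr_hom ((cc a i N).w (homOfLE h).op.op) e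

lemma exists_map_eq_zero {D : (ℕᵒᵖ)ᵒᵖ ⥤ ModuleCat.{0} R} {c : Cocone D} (hc : IsColimit c) (k : ℕ)
    (e : D.obj (op (op k))) (h : c.ι.app (op (op k)) e = 0) :
    ∃ (l : ℕ) (h : k ≤ l), D.map (homOfLE h).op.op e = 0 := by
  obtain ⟨j, f, g, hf⟩ := Concrete.isColimit_exists_of_rep_eq D hc e (0 : D.obj (op (op k)))
    (h.trans (map_zero _).symm)
  refine ⟨j.unop.unop, leOfHom f.unop.unop, ?_⟩
  rw [map_zero] at hf
  exact hf

lemma io_eq_zero {k : ℕ} (x : Abelian.Ext (Q a k) (ModuleCat.of R N) i) (hx : io a i N k x = 0) :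
    ∃ (l : ℕ) (h : k ≤ l), (Abelian.Ext.mk₀ (tr a h)).comp x (zero_add i) = 0 := by
  obtain ⟨e, rfl⟩ := cmp_surjective i x
  obtain ⟨l, h, h0⟩ := exists_map_eq_zero (ccIsColimit a i N) k e ((io_cmp a i N k e).symm.trans hx)
  refine ⟨l, h, (dg_map h e).symm.trans ?_⟩
  rw [h0]
  exact map_zero _

variable (a i) in
/-- The map induced on local cohomology by a linear map. -/
def lcMap {N N' : Type} [AddCommGroup N] [Module R N] [AddCommGroup N'] [Module R N']
    (f : N →ₗ[R] N') : Paper.H R a i N →ₗ[R] Paper.H R a i N' :=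
  ((localCohomology a i).map (ModuleCat.ofHom f)).hom

variable {N' : Type} [AddCommGroup N'] [Module R N']

lemma lcMap_io (f : N →ₗ[R] N') (k : ℕ) (x : Abelian.Ext (Q a k) (ModuleCat.of R N) i) :
    lcMap a i f (io a i N k x) =
      io a i N' k (x.comp (Abelian.Ext.mk₀ (ModuleCat.ofHom f)) (add_zero i)) := by
  obtain ⟨e, rfl⟩ := cmp_surjective i x
  rw [← cmp_postcomp, io_cmp, io_cmp]
  exact (ConcreteCategory.congr_hom ((colimit.ι (localCohomology.diagram
    (localCohomology.idealPowersDiagram a) i) (op (op k))).naturality (ModuleCat.ofHom f)) e).symm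

@[simp] lemma lcMap_id (y : Paper.H R a i N) : lcMap a i (LinearMap.id : N →ₗ[R] N) y = y :=
  ConcreteCategory.congr_hom ((localCohomology a i).map_id (ModuleCat.of R N)) y

lemma lcMap_comp {N'' : Type} [AddCommGroup N''] [Module R N''] (g : N' →ₗ[R] N'')
    (f : N →ₗ[R] N') (y : Paper.H R a i N) :
    lcMap a i (g ∘ₗ f) y = lcMap a i g (lcMap a i f y) :=
  ConcreteCategory.congr_hom ((localCohomology a i).map_comp (ModuleCat.ofHom f)
    (ModuleCat.ofHom g)) y

lemma lcMap_smul (r : R) (f : N →ₗ[R] N') (y : Paper.H R a i N) :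
    lcMap a i (r • f) y = r • lcMap a i f y := by
  obtain ⟨k, x, rfl⟩ := io_surj a i N y
  rw [lcMap_io, lcMap_io, ← map_smul, ← Abelian.Ext.comp_smul, ← Abelian.Ext.mk₀_smul]
  rfl

lemma lcMap_zero (y : Paper.H R a i N) : lcMap a i (0 : N →ₗ[R] N') y = 0 := by
  have := lcMap_smul (0 : R) (0 : N →ₗ[R] N') y
  rwa [zero_smul, zero_smul] at this

lemma io_wd {V : Type} [AddCommGroup V] [Module R V]
    (φ : ∀ k, Abelian.Ext (Q a k) (ModuleCat.of R N) i →ₗ[R] V)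
    (hφ : ∀ k l (h : k ≤ l) x, φ l ((Abelian.Ext.mk₀ (tr a h)).comp x (zero_add i)) = φ k x)
    {k l : ℕ} (x : Abelian.Ext (Q a k) (ModuleCat.of R N) i)
    (y : Abelian.Ext (Q a l) (ModuleCat.of R N) i) (h : io a i N k x = io a i N l y) :
    φ k x = φ l y := by
  rw [← hφ k _ (le_max_left k l), ← hφ l _ (le_max_right k l), ← sub_eq_zero, ← map_sub]
  rw [← io_tr (le_max_left k l), ← io_tr (le_max_right k l), ← sub_eq_zero, ← map_sub] at h
  obtain ⟨m, hm, h0⟩ := io_eq_zero _ h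
  rw [← hφ _ _ hm, h0, map_zero]

/-- A compatible family of linear maps descends to local cohomology. -/
def desc {V : Type} [AddCommGroup V] [Module R V]
    (φ : ∀ k, Abelian.Ext (Q a k) (ModuleCat.of R N) i →ₗ[R] V)
    (hφ : ∀ k l (h : k ≤ l) x, φ l ((Abelian.Ext.mk₀ (tr a h)).comp x (zero_add i)) = φ k x) :
    Paper.H R a i N →ₗ[R] V where
  toFun y := φ _ (io_surj a i N y).choose_spec.choose
  map_add' y z := by
    obtain ⟨k, x, rfl⟩ := io_surj a i N y
    obtain ⟨l, x', rfl⟩ := io_surj a i N z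
    have h1 := (io_surj a i N (io a i N k x)).choose_spec.choose_spec
    have h2 := (io_surj a i N (io a i N l x')).choose_spec.choose_spec
    have h3 := (io_surj a i N (io a i N k x + io a i N l x')).choose_spec.choose_spec
    rw [io_wd φ hφ _ _ h1, io_wd φ hφ _ _ h2, ← hφ k _ (le_max_left k l),
      ← hφ l _ (le_max_right k l), ← map_add]
    apply io_wd φ hφ
    rw [h3, map_add, io_tr, io_tr]
  map_smul' r y := by
    obtain ⟨k, x, rfl⟩ := io_surj a i N y
    have h1 := (io_surj a i N (io a i N k x)).choose_spec.choose_spec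
    have h3 := (io_surj a i N (r • io a i N k x)).choose_spec.choose_spec
    rw [io_wd φ hφ _ _ h1, RingHom.id_apply, ← (φ k).map_smul]
    apply io_wd φ hφ
    rw [h3, map_smul]

lemma desc_io {V : Type} [AddCommGroup V] [Module R V]
    (φ : ∀ k, Abelian.Ext (Q a k) (ModuleCat.of R N) i →ₗ[R] V)
    (hφ : ∀ k l (h : k ≤ l) x, φ l ((Abelian.Ext.mk₀ (tr a h)).comp x (zero_add i)) = φ k x)
    (k : ℕ) (x) : desc φ hφ (io a i N k x) = φ k x :=
  io_wd φ hφ _ _ (io_surj a i N (io a i N k x)).choose_spec.choose_spec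

lemma exists_pow_smul_eq_zero (y : Paper.H R a i N) : ∃ k, ∀ r ∈ a ^ k, r • y = 0 := by
  obtain ⟨k, x, rfl⟩ := io_surj a i N y
  refine ⟨k, fun r hr => ?_⟩
  rw [← map_smul, ← Abelian.Ext.mk₀_id_comp x, ← Abelian.Ext.smul_comp, ← Abelian.Ext.mk₀_smul]
  have : r • 𝟙 (Q a k) = 0 := by
    ext
    change r • (Ideal.Quotient.mk (a ^ k) 1) = 0
    rw [← Ideal.Quotient.mk_eq_mk, ← Submodule.Quotient.mk_smul, Submodule.Quotient.mk_eq_zero]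
    simpa using hr
  rw [this, Abelian.Ext.mk₀_zero, Abelian.Ext.zero_comp, map_zero]

lemma eq_zero_of_injective [Injective (ModuleCat.of R N)] (y : Paper.H R a (i + 1) N) : y = 0 := by
  obtain ⟨k, x, rfl⟩ := io_surj a _ N y
  rw [Abelian.Ext.eq_zero_of_injective x, map_zero]

/-- Composition with an `Ext` class. -/
def lcExt {j : ℕ} (θ : Abelian.Ext (ModuleCat.of R N) (ModuleCat.of R N') j) {n : ℕ}
    (h : i + j = n) : Paper.H R a i N →ₗ[R] Paper.H R a n N' :=
  desc (fun k => io a n N' k ∘ₗ Abelian.Ext.postcompOfLinear θ R (Q a k) h) (by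
    intro k l hkl x
    change io a n N' l (((Abelian.Ext.mk₀ (tr a hkl)).comp x (zero_add i)).comp θ h) =
      io a n N' k (x.comp θ h)
    rw [Abelian.Ext.comp_assoc _ _ _ (zero_add i) h (by lia), io_tr])

lemma lcExt_io {j : ℕ} (θ : Abelian.Ext (ModuleCat.of R N) (ModuleCat.of R N') j) {n : ℕ}
    (h : i + j = n) (k : ℕ) (x) :
    lcExt θ h (io a i N k x) = io a n N' k (x.comp θ h) := desc_io _ _ _ _

/-- The long exact sequence of local cohomology. -/
theorem lc_exact {N₁ N₂ N₃ : Type} [AddCommGroup N₁] [Module R N₁] [AddCommGroup N₂] [Module R N₂]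
    [AddCommGroup N₃] [Module R N₃] (a : Ideal R) (f : N₁ →ₗ[R] N₂) (g : N₂ →ₗ[R] N₃)
    (hf : Function.Injective f) (hfg : Function.Exact f g) (hg : Function.Surjective g) :
    (∀ i (y : Paper.H R a i N₂), lcMap a i g y = 0 → ∃ x, lcMap a i f x = y) ∧
    ∃ δ : ∀ i, Paper.H R a i N₃ →ₗ[R] Paper.H R a (i + 1) N₁,
      (∀ i y, δ i y = 0 → ∃ x, lcMap a i g x = y) ∧
      (∀ i y, lcMap a (i + 1) f y = 0 → ∃ x, δ i x = y) ∧
      (∀ i x, δ i (lcMap a i g x) = 0) ∧ (∀ i x, lcMap a (i + 1) f (δ i x) = 0) := by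
  let S : ShortComplex (ModuleCat.{0} R) := ShortComplex.mk (ModuleCat.ofHom f) (ModuleCat.ofHom g)
    (by ext x; exact (hfg (f x)).2 ⟨x, rfl⟩)
  have hS : S.ShortExact :=
    { exact := by
        rw [ShortComplex.moduleCat_exact_iff]
        exact fun x hx => (hfg x).1 hx
      mono_f := (ModuleCat.mono_iff_injective _).2 hf
      epi_g := (ModuleCat.epi_iff_surjective _).2 hg }
  have hassoc₀ : ∀ {X : ModuleCat.{0} R} {k l : ℕ} (h : k ≤ l) {n : ℕ}
      (x : Abelian.Ext (Q a k) X n) {Y : ModuleCat.{0} R} {j m : ℕ} (θ : Abelian.Ext X Y j)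
      (hm : n + j = m),
      ((Abelian.Ext.mk₀ (tr a h)).comp x (zero_add n)).comp θ hm =
      (Abelian.Ext.mk₀ (tr a h)).comp (x.comp θ hm) (zero_add m) := by
    intros
    rw [Abelian.Ext.comp_assoc _ _ _ _ _ (by lia)]
  refine ⟨?_, fun i => lcExt hS.extClass rfl, ?_, ?_, ?_, ?_⟩
  · intro i y hy
    obtain ⟨k, x, rfl⟩ := io_surj a _ _ y
    rw [lcMap_io] at hy
    obtain ⟨l, hl, h0⟩ := io_eq_zero _ hy
    rw [← hassoc₀] at h0
    obtain ⟨z, hz⟩ := Abelian.Ext.covariant_sequence_exact₂ _ hS _ h0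
    exact ⟨io a i N₁ l z, by rw [lcMap_io, ← io_tr hl, ← hz]⟩
  · intro i y hy
    obtain ⟨k, x, rfl⟩ := io_surj a _ _ y
    rw [lcExt_io] at hy
    obtain ⟨l, hl, h0⟩ := io_eq_zero _ hy
    rw [← hassoc₀] at h0
    obtain ⟨z, hz⟩ := Abelian.Ext.covariant_sequence_exact₃ _ hS _ rfl h0
    exact ⟨io a i N₂ l z, by rw [lcMap_io, ← io_tr hl, ← hz]⟩
  · intro i y hy
    obtain ⟨k, x, rfl⟩ := io_surj a _ _ y
    rw [lcMap_io] at hy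
    obtain ⟨l, hl, h0⟩ := io_eq_zero _ hy
    rw [← hassoc₀] at h0
    obtain ⟨z, hz⟩ := Abelian.Ext.covariant_sequence_exact₁ _ hS _ h0 rfl
    exact ⟨io a i N₃ l z, by rw [lcExt_io, ← io_tr hl, ← hz]⟩
  · intro i y
    obtain ⟨k, x, rfl⟩ := io_surj a _ _ y
    rw [lcMap_io, lcExt_io, Abelian.Ext.comp_assoc _ _ _ _ (zero_add 1) (by lia)]
    erw [hS.comp_extClass]
    rw [Abelian.Ext.comp_zero, map_zero]
  · intro i y
    obtain ⟨k, x, rfl⟩ := io_surj a _ _ y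
    rw [lcExt_io, lcMap_io, Abelian.Ext.comp_assoc _ _ _ _ (add_zero 1) (by lia)]
    erw [hS.extClass_comp]
    rw [Abelian.Ext.comp_zero, map_zero]

/-- Evaluation of degree-zero local cohomology classes. -/
def ev (a : Ideal R) (N : Type) [AddCommGroup N] [Module R N] : Paper.H R a 0 N →ₗ[R] N :=
  desc (fun k =>
    { toFun := fun x => (Abelian.Ext.linearEquiv₀ (R := R) x).hom (Submodule.Quotient.mk 1)
      map_add' := fun x y => by rw [map_add]; rfl
      map_smul' := fun r x => by rw [map_smul]; rfl }) (by
    intro k l h x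
    obtain ⟨f, rfl⟩ := (Abelian.Ext.linearEquiv₀ (R := R)).symm.surjective x
    simp only [Abelian.Ext.linearEquiv₀_symm_apply, LinearMap.coe_mk, AddHom.coe_mk]
    have h1 : ∀ {X : ModuleCat.{0} R} (f : X ⟶ ModuleCat.of R N),
      Abelian.Ext.linearEquiv₀ (R := R) (Abelian.Ext.mk₀ f) = f := fun f =>
        (Abelian.Ext.linearEquiv₀ (R := R)).apply_symm_apply f
    erw [Abelian.Ext.mk₀_comp_mk₀, h1, h1]
    rfl)

lemma ev_io (k : ℕ) (f : Q a k ⟶ ModuleCat.of R N) :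
    ev a N (io a 0 N k (Abelian.Ext.mk₀ f)) = f.hom (Submodule.Quotient.mk 1) := by
  unfold ev
  rw [desc_io]
  have h1 : Abelian.Ext.linearEquiv₀ (R := R) (Abelian.Ext.mk₀ f) = f :=
        (Abelian.Ext.linearEquiv₀ (R := R)).apply_symm_apply f
  change (Abelian.Ext.linearEquiv₀ (R := R) (Abelian.Ext.mk₀ f)).hom _ = _
  rw [h1]

lemma io_mk₀_surj (y : Paper.H R a 0 N) :
    ∃ k, ∃ f : Q a k ⟶ ModuleCat.of R N, io a 0 N k (Abelian.Ext.mk₀ f) = y := by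
  obtain ⟨k, x, rfl⟩ := io_surj a _ _ y
  exact ⟨k, Abelian.Ext.addEquiv₀ x, by rw [Abelian.Ext.mk₀_addEquiv₀_apply]⟩

lemma ev_lcMap (f : N →ₗ[R] N') (y : Paper.H R a 0 N) : ev a N' (lcMap a 0 f y) = f (ev a N y) := by
  obtain ⟨k, g, rfl⟩ := io_mk₀_surj y
  rw [lcMap_io, Abelian.Ext.mk₀_comp_mk₀, ev_io, ev_io]
  rfl

lemma ev_injective : Function.Injective (ev a N) := by
  rw [injective_iff_map_eq_zero]
  intro y hy
  obtain ⟨k, g, rfl⟩ := io_mk₀_surj y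
  rw [ev_io] at hy
  have : g = 0 := by
    ext; exact hy
  rw [this, Abelian.Ext.mk₀_zero, map_zero]

lemma mem_range_ev (n : N) : n ∈ LinearMap.range (ev a N) ↔ ∃ k, ∀ r ∈ a ^ k, r • n = 0 := by
  constructor
  · rintro ⟨y, rfl⟩
    obtain ⟨k, hk⟩ := exists_pow_smul_eq_zero y
    exact ⟨k, fun r hr => by rw [← map_smul, hk r hr, map_zero]⟩
  · rintro ⟨k, hk⟩
    let g : Q a k ⟶ ModuleCat.of R N := ModuleCat.ofHom
      ((a ^ k).liftQ (LinearMap.toSpanSingleton R N n) (fun r hr => by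
        simpa using hk r hr))
    refine ⟨io a 0 N k (Abelian.Ext.mk₀ g), ?_⟩
    rw [ev_io]
    exact (Submodule.liftQ_apply _ _ _).trans (by simp)

end

section

open CategoryTheory Limits Opposite

variable {R : Type} [CommRing R]
variable {a : Ideal R} {i : ℕ} {N N' : Type} [AddCommGroup N] [Module R N]
  [AddCommGroup N'] [Module R N']

lemma subsingleton_of_subsingleton [Subsingleton N] : Subsingleton (Paper.H R a i N) := by
  refine subsingleton_of_forall_eq 0 fun y => ?_
  rw [← lcMap_id y, Subsingleton.elim (LinearMap.id : N →ₗ[R] N) 0, lcMap_zero]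

lemma lcMap_lsmul (r : R) (y : Paper.H R a i N) : lcMap a i (LinearMap.lsmul R N r) y = r • y := by
  have : LinearMap.lsmul R N r = r • LinearMap.id := by ext; simp
  rw [this, lcMap_smul, lcMap_id]

variable (a N) in
/-- The submodule of elements killed by a power of `a`. -/
def tors : Submodule R N := LinearMap.range (ev a N)

lemma mem_tors {n : N} : n ∈ tors a N ↔ ∃ k, ∀ r ∈ a ^ k, r • n = 0 := mem_range_ev n

lemma tors_tors : tors a (tors a N) = ⊤ := by
  rw [eq_top_iff]
  rintro ⟨n, hn⟩ -
  obtain ⟨k, hk⟩ := mem_tors.1 hn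
  exact mem_tors.2 ⟨k, fun r hr => Subtype.ext (hk r hr)⟩

lemma exists_pow_smul_eq_zero_of_fg {K : Submodule R N} (hK : K.FG) (h : K ≤ tors a N) :
    ∃ k, ∀ r ∈ a ^ k, ∀ x ∈ K, r • x = 0 := by
  obtain ⟨s, rfl⟩ := hK
  have : ∀ x ∈ s, ∃ k, ∀ r ∈ a ^ k, r • x = 0 := fun x hx =>
    mem_tors.1 (h (Submodule.subset_span hx))
  choose! k hk using this
  refine ⟨s.sup k, fun r hr x hx => ?_⟩
  have hle : Submodule.span R (s : Set N) ≤ LinearMap.ker (LinearMap.lsmul R N r) :=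
    Submodule.span_le.2 fun x hx => hk x hx r (Ideal.pow_le_pow_right (Finset.le_sup hx) hr)
  exact hle hx

lemma tors_quotient [IsNoetherianRing R] : tors a (N ⧸ tors a N) = ⊥ := by
  rw [eq_bot_iff]
  intro n hn
  obtain ⟨n, rfl⟩ := Submodule.Quotient.mk_surjective _ n
  obtain ⟨k, hk⟩ := mem_tors.1 hn
  have hK : (Submodule.map (LinearMap.toSpanSingleton R N n) (a ^ k)).FG :=
    (IsNoetherian.noetherian (a ^ k)).map _
  obtain ⟨l, hl⟩ := exists_pow_smul_eq_zero_of_fg (a := a) hK (by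
    rintro _ ⟨r, hr, rfl⟩
    have := hk r hr
    rwa [← Submodule.Quotient.mk_smul, Submodule.Quotient.mk_eq_zero] at this)
  rw [Submodule.mem_bot, Submodule.Quotient.mk_eq_zero, mem_tors]
  refine ⟨l + k, fun r hr => ?_⟩
  rw [pow_add] at hr
  refine Submodule.mul_induction_on hr (fun s hs t ht => ?_) fun s t hs ht => ?_
  · rw [mul_smul]
    exact hl s hs _ ⟨t, ht, rfl⟩
  · rw [add_smul, hs, ht, add_zero]

lemma baer_tors [IsNoetherianRing R] (hN : Module.Injective R N) : Module.Baer R (tors a N) := by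
  intro b f
  obtain ⟨k, hk⟩ := exists_pow_smul_eq_zero_of_fg (a := a)
    (K := LinearMap.range ((tors a N).subtype ∘ₗ f))
    (by rw [LinearMap.range_eq_map]; exact Module.Finite.fg_top.map _)
    (by rintro _ ⟨x, rfl⟩; exact (f x).2)
  obtain ⟨n, hn⟩ := Ideal.exists_pow_inf_eq_pow_smul a (M := R) b
  set c : Ideal R := a ^ (n + k) with hc
  have hcb : ∀ x : b, (x : R) ∈ c → (f x : N) = 0 := by
    intro x hx
    have h1 : (x : R) ∈ a ^ k • b := by
      have h2 : (x : R) ∈ a ^ (n + k) • (⊤ : Ideal R) ⊓ b :=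
        ⟨by simpa using hx, x.2⟩
      rw [hn (n + k) (Nat.le_add_right _ _), Nat.add_sub_cancel_left] at h2
      exact Submodule.smul_mono le_rfl inf_le_right h2
    have h3 : x ∈ a ^ k • (⊤ : Submodule R b) := by
      have h2 : (x : R) ∈ Submodule.map b.subtype (a ^ k • (⊤ : Submodule R b)) := by
        rw [Submodule.map_smul'', Submodule.map_top, Submodule.range_subtype]
        exact h1
      obtain ⟨z, hz, hzx⟩ := h2
      rwa [← Subtype.ext (a1 := z) (a2 := x) hzx]
    refine Submodule.smul_induction_on h3 (fun r hr y _ => ?_) fun y z hy hz => ?_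
    · rw [map_smul]
      exact hk r hr _ ⟨y, rfl⟩
    · rw [map_add, Submodule.coe_add, hy, hz, add_zero]
  let g : (b ⧸ Submodule.comap b.subtype c) →ₗ[R] R ⧸ c := Submodule.mapQ _ _ b.subtype le_rfl
  have hg : Function.Injective g := by
    rw [← LinearMap.ker_eq_bot, Submodule.ker_mapQ, Submodule.mkQ_map_self]
  obtain ⟨h, hh⟩ := hN.out g hg (Submodule.liftQ _ ((tors a N).subtype ∘ₗ f) fun x hx => hcb x hx)
  have hmem : ∀ r, h (Submodule.Quotient.mk r) ∈ tors a N := by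
    intro r
    refine mem_tors.2 ⟨n + k, fun s hs => ?_⟩
    rw [← map_smul, ← Submodule.Quotient.mk_smul, (Submodule.Quotient.mk_eq_zero c).2, map_zero]
    exact c.mul_mem_right r hs
  refine ⟨(h ∘ₗ c.mkQ).codRestrict _ hmem, fun x hx => Subtype.ext ?_⟩
  exact hh (Submodule.Quotient.mk ⟨x, hx⟩)

lemma exists_injective_embedding [IsNoetherianRing R] (hN : tors a N = ⊤) :
    ∃ (J : Type) (_ : AddCommGroup J) (_ : Module R J) (f : N →ₗ[R] J),
      CategoryTheory.Injective (ModuleCat.of R J) ∧ tors a J = ⊤ ∧ Function.Injective f := by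
  let I : ModuleCat.{0} R := Injective.under (ModuleCat.of R N)
  let f₀ : N →ₗ[R] I := (Injective.ι (ModuleCat.of R N)).hom
  have hf₀ : Function.Injective f₀ := (ModuleCat.mono_iff_injective _).1 inferInstance
  have hI : CategoryTheory.Injective (ModuleCat.of R I) :=
    inferInstanceAs (CategoryTheory.Injective (Injective.under (ModuleCat.of R N)))
  have hI' : Module.Injective R I := Module.injective_module_of_injective_object R I
  let f : N →ₗ[R] tors a I := f₀.codRestrict _ fun x => by
    obtain ⟨k, hk⟩ := mem_tors.1 (hN ▸ Submodule.mem_top : x ∈ tors a N)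
    exact mem_tors.2 ⟨k, fun r hr => by rw [← map_smul, hk r hr, map_zero]⟩
  have hJ : Module.Injective R (tors a I) := (baer_tors hI').injective
  exact ⟨tors a I, inferInstance, inferInstance, f,
    Module.injective_object_of_injective_module R _, tors_tors,
    fun x y h => hf₀ (congrArg Subtype.val h)⟩

lemma tors_eq_top_of_surjective (f : N →ₗ[R] N') (hf : Function.Surjective f)
    (hN : tors a N = ⊤) : tors a N' = ⊤ := by
  rw [eq_top_iff]
  rintro x -
  obtain ⟨x, rfl⟩ := hf x
  obtain ⟨k, hk⟩ := mem_tors.1 (hN ▸ Submodule.mem_top : x ∈ tors a N)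
  exact mem_tors.2 ⟨k, fun r hr => by rw [← map_smul, hk r hr, map_zero]⟩

lemma lcMap_zero_surjective (f : N →ₗ[R] N') (hf : Function.Surjective f)
    (hN : tors a N = ⊤) : Function.Surjective (lcMap a 0 f) := by
  intro x
  obtain ⟨z, hz⟩ := hf (ev a _ x)
  obtain ⟨w, rfl⟩ : z ∈ tors a N := hN ▸ Submodule.mem_top
  rw [← ev_lcMap] at hz
  exact ⟨w, ev_injective hz⟩

theorem subsingleton_of_tors_eq_top [IsNoetherianRing R] (a : Ideal R) :
    ∀ (i : ℕ) (N : Type) [AddCommGroup N] [Module R N], tors a N = ⊤ →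
      Subsingleton (Paper.H R a (i + 1) N) := by
  have key : ∀ (i : ℕ) (N : Type) [AddCommGroup N] [Module R N], tors a N = ⊤ →
      (i ≠ 0 → ∀ (C : Type) [AddCommGroup C] [Module R C], tors a C = ⊤ →
        Subsingleton (Paper.H R a i C)) → Subsingleton (Paper.H R a (i + 1) N) := by
    intro i N _ _ hN ih
    obtain ⟨J, _, _, f, hJ, hJt, hf⟩ := exists_injective_embedding hN
    obtain ⟨-, δ, -, h2, h3, -⟩ := lc_exact a f (LinearMap.range f).mkQ hf
      (LinearMap.exact_map_mkQ_range f) (Submodule.mkQ_surjective _)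
    refine subsingleton_of_forall_eq 0 fun y => ?_
    obtain ⟨x, rfl⟩ := h2 _ y (eq_zero_of_injective _)
    rcases i with _ | i
    · obtain ⟨w, rfl⟩ := lcMap_zero_surjective _ (Submodule.mkQ_surjective _) hJt x
      exact h3 _ _
    · have := ih i.succ_ne_zero _
        (tors_eq_top_of_surjective _ (Submodule.mkQ_surjective (LinearMap.range f)) hJt)
      rw [Subsingleton.elim x 0, map_zero]
  intro i
  induction i with
  | zero => exact fun N _ _ hN => key 0 N hN (by simp)
  | succ i ih => exact fun N _ _ hN => key _ N hN fun _ C _ _ hC => ih C hC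

/-- The kernel of `N → N ⧸ tors a N` does not contribute to higher local cohomology. -/
theorem lcMap_tors_mkQ_bijective [IsNoetherianRing R] (a : Ideal R) (i : ℕ) (N : Type)
    [AddCommGroup N] [Module R N] :
    Function.Bijective (lcMap a (i + 1) (tors a N).mkQ) := by
  obtain ⟨h0, δ, h1, -, -, -⟩ := lc_exact a (tors a N).subtype (tors a N).mkQ
    (Submodule.injective_subtype _) (LinearMap.exact_subtype_mkQ _) (Submodule.mkQ_surjective _)
  have hs := fun i => subsingleton_of_tors_eq_top a i (tors a N) tors_tors
  constructor
  · rw [injective_iff_map_eq_zero]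
    intro y hy
    obtain ⟨x, rfl⟩ := h0 _ y hy
    have := hs i
    rw [Subsingleton.elim x 0, map_zero]
  · intro y
    have := hs (i + 1)
    exact h1 _ y (Subsingleton.elim _ _)

lemma subsingleton_of_quotient_tors [IsNoetherianRing R]
    [Subsingleton (Paper.H R a (i + 1) (N ⧸ tors a N))] : Subsingleton (Paper.H R a (i + 1) N) :=
  (lcMap_tors_mkQ_bijective a i N).1.subsingleton

lemma not_le_of_mem_associatedPrimes [IsNoetherianRing R] (hN : tors a N = ⊥) {p : Ideal R}
    (hp : p ∈ associatedPrimes R N) : ¬ a ≤ p := by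
  intro hap
  obtain ⟨hp', n, hn⟩ := Submodule.isAssociatedPrime_iff.1 hp
  have hn' : n ∈ tors a N := mem_tors.2 ⟨1, fun r hr => by
    have : r ∈ p := hap (by simpa using hr)
    simpa [hn, Submodule.mem_colon_singleton] using this⟩
  rw [hN, Submodule.mem_bot] at hn'
  refine hp'.ne_top ((Ideal.eq_top_iff_one _).2 ?_)
  rw [hn, hn', Submodule.mem_colon_singleton]
  simp

lemma exists_isSMulRegular [IsNoetherianRing R] [Module.Finite R N] (hN : tors a N = ⊥) :
    ∃ x ∈ a, IsSMulRegular N x := by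
  by_contra! h
  have h1 : (a : Set R) ⊆ ⋃ p ∈ associatedPrimes R N, (p : Set R) := by
    rw [biUnion_associatedPrimes_eq_compl_regular]
    exact fun x hx => h x hx
  obtain ⟨p, hp, hap⟩ := (Ideal.subset_union_prime_finite (associatedPrimes.finite R N) (f := id)
    0 0 fun p hp _ _ => hp.1).1 h1
  exact not_le_of_mem_associatedPrimes hN hp hap

end

section

open CategoryTheory Limits Opposite

variable {R : Type} [CommRing R]
variable {a : Ideal R} {i : ℕ} {N N' : Type} [AddCommGroup N] [Module R N]
  [AddCommGroup N'] [Module R N']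

open Pointwise in
lemma exact_lsmul (x : R) : Function.Exact (LinearMap.lsmul R N x)
    (Submodule.mkQ (x • (⊤ : Submodule R N))) := by
  intro y
  rw [Submodule.mkQ_apply, Submodule.Quotient.mk_eq_zero]
  constructor
  · rintro ⟨z, -, rfl⟩
    exact ⟨z, rfl⟩
  · rintro ⟨z, rfl⟩
    exact ⟨z, trivial, rfl⟩

open Pointwise in
theorem lc_exact_regular (a : Ideal R) {x : R} (hx : IsSMulRegular N x) :
    (∀ i (y : Paper.H R a i N), lcMap a i (Submodule.mkQ (x • (⊤ : Submodule R N))) y = 0 →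
      ∃ z : Paper.H R a i N, x • z = y) ∧
    ∃ δ : ∀ i, Paper.H R a i (QuotSMulTop x N) →ₗ[R] Paper.H R a (i + 1) N,
      (∀ i y, δ i y = 0 → ∃ z, lcMap a i (Submodule.mkQ (x • (⊤ : Submodule R N))) z = y) ∧
      (∀ i (y : Paper.H R a (i + 1) N), x • y = 0 → ∃ z, δ i z = y) ∧
      (∀ i z, x • δ i z = 0) := by
  obtain ⟨h0, δ, h1, h2, -, h4⟩ := lc_exact a (LinearMap.lsmul R N x)
    (Submodule.mkQ (x • (⊤ : Submodule R N))) hx (exact_lsmul x) (Submodule.mkQ_surjective _)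
  simp only [lcMap_lsmul] at h0 h2 h4
  exact ⟨h0, δ, h1, h2, h4⟩

lemma exists_pow_smul_eq_zero_of_mem {x : R} (hx : x ∈ a) (y : Paper.H R a i N) :
    ∃ k, x ^ k • y = 0 := by
  obtain ⟨k, hk⟩ := exists_pow_smul_eq_zero y
  exact ⟨k, hk _ (Ideal.pow_mem_pow hx k)⟩

lemma subsingleton_of_isSMulRegular {x : R} (hx : x ∈ a) (hreg : IsSMulRegular N x)
    [hs : Subsingleton (Paper.H R a i (QuotSMulTop x N))] :
    Subsingleton (Paper.H R a (i + 1) N) := by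
  obtain ⟨-, δ, -, h, -⟩ := lc_exact_regular a hreg
  have h0 : ∀ y : Paper.H R a (i + 1) N, x • y = 0 → y = 0 := by
    intro y hy
    obtain ⟨z, rfl⟩ := h _ y hy
    rw [Subsingleton.elim z 0, map_zero]
  refine subsingleton_of_forall_eq 0 fun y => ?_
  obtain ⟨k, hk⟩ := exists_pow_smul_eq_zero_of_mem hx y
  induction k with
  | zero => simpa using hk
  | succ k ih =>
    rw [pow_succ', mul_smul] at hk
    exact ih (h0 _ hk)

/-- Local cohomology vanishes above the dimension. -/
theorem subsingleton_of_supportDim_lt [IsNoetherianRing R] [IsLocalRing R]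
    (ha : a ≤ IsLocalRing.maximalIdeal R) :
    ∀ (i : ℕ) (N : Type) [AddCommGroup N] [Module R N] [Module.Finite R N],
      Module.supportDim R N < i → Subsingleton (Paper.H R a i N) := by
  intro i
  induction i with
  | zero =>
    intro N _ _ _ h
    have : Subsingleton N := by
      rw [← Module.supportDim_eq_bot_iff_subsingleton (R := R), ← WithBot.lt_coe_bot]
      exact h
    exact subsingleton_of_subsingleton
  | succ i ih =>
    intro N _ _ _ h
    suffices Subsingleton (Paper.H R a (i + 1) (N ⧸ tors a N)) from subsingleton_of_quotient_tors
    obtain ⟨x, hxa, hx⟩ := exists_isSMulRegular (tors_quotient (a := a) (N := N))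
    rcases subsingleton_or_nontrivial (N ⧸ tors a N) with hs | hs
    · exact subsingleton_of_subsingleton
    have h1 := Module.supportDim_quotSMulTop_succ_eq_supportDim hx (ha hxa)
    have h2 := Module.supportDim_le_of_surjective (tors a N).mkQ (Submodule.mkQ_surjective _)
    have h3 : Module.supportDim R (QuotSMulTop x (N ⧸ tors a N)) < i := by
      have h4 := h1.trans_le h2 |>.trans_lt h
      push_cast at h4
      exact lt_of_add_lt_add_right h4
    have := ih _ h3
    exact subsingleton_of_isSMulRegular hxa hx

lemma tors_eq_top_of_le_radical [IsNoetherianRing R]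
    (h : a ≤ (Module.annihilator R N).radical) : tors a N = ⊤ := by
  obtain ⟨k, hk⟩ := Ideal.exists_pow_le_of_le_radical_of_fg h (IsNoetherian.noetherian a)
  rw [eq_top_iff]
  exact fun n _ => mem_tors.2 ⟨k, fun r hr => Module.mem_annihilator.1 (hk hr) n⟩

lemma annihilator_le_of_surjective (f : N →ₗ[R] N') (hf : Function.Surjective f) :
    Module.annihilator R N ≤ Module.annihilator R N' :=
  f.annihilator_le_of_surjective hf

lemma mem_annihilator_quotSMulTop (x : R) : x ∈ Module.annihilator R (QuotSMulTop x N) := by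
  rw [Module.mem_annihilator]
  intro y
  obtain ⟨y, rfl⟩ := Submodule.Quotient.mk_surjective _ y
  rw [← Submodule.Quotient.mk_smul, Submodule.Quotient.mk_eq_zero]
  exact ⟨y, trivial, rfl⟩

/-- Local cohomology vanishes above the number of elements generating the ideal up to radical
modulo the annihilator. -/
theorem subsingleton_of_card_lt [IsNoetherianRing R] [IsLocalRing R] :
    ∀ (r : ℕ) (s : Finset R), s.card ≤ r → Ideal.span (s : Set R) ≤ a →
      ∀ (i : ℕ) (N : Type) [AddCommGroup N] [Module R N] [Module.Finite R N],
      a ≤ (Ideal.span (s : Set R) ⊔ Module.annihilator R N).radical → r < i →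
      Subsingleton (Paper.H R a i N) := by
  classical
  intro r
  induction r with
  | zero =>
    intro s hs _ i N _ _ _ ha hi
    obtain ⟨i, rfl⟩ := Nat.exists_eq_succ_of_ne_zero hi.ne'
    obtain rfl : s = ∅ := Finset.card_eq_zero.1 (Nat.le_zero.1 hs)
    exact subsingleton_of_tors_eq_top a i N (tors_eq_top_of_le_radical (by simpa using ha))
  | succ r ih =>
    intro s hs hsa i N _ _ _ ha hi
    obtain ⟨i, rfl⟩ := Nat.exists_eq_succ_of_ne_zero (by lia : i ≠ 0)
    suffices Subsingleton (Paper.H R a (i + 1) (N ⧸ tors a N)) from subsingleton_of_quotient_tors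
    set N₁ := N ⧸ tors a N
    have ha₁ : a ≤ (Ideal.span (s : Set R) ⊔ Module.annihilator R N₁).radical :=
      ha.trans (Ideal.radical_mono (sup_le_sup_left
        (annihilator_le_of_surjective (tors a N).mkQ (Submodule.mkQ_surjective _)) _))
    set I := Ideal.span (s : Set R) with hI
    by_cases hI0 : I ≤ IsLocalRing.maximalIdeal R • I
    · have hbot : I = ⊥ := Submodule.eq_bot_of_le_smul_of_le_jacobson_bot _ _
        (IsNoetherian.noetherian _) hI0 (IsLocalRing.maximalIdeal_le_jacobson _)
      rw [hbot, bot_sup_eq] at ha₁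
      exact subsingleton_of_tors_eq_top a i _ (tors_eq_top_of_le_radical ha₁)
    obtain ⟨x, hxI, hxm, hx⟩ : ∃ x ∈ I, x ∉ IsLocalRing.maximalIdeal R • I ∧
        IsSMulRegular N₁ x := by
      by_contra! h
      have h1 : (I : Set R) ⊆ ⋃ p ∈ insert (IsLocalRing.maximalIdeal R • I)
          (associatedPrimes R N₁), (p : Set R) := by
        rw [Set.biUnion_insert, biUnion_associatedPrimes_eq_compl_regular]
        exact fun x hx => or_iff_not_imp_left.2 (h x hx)
      obtain ⟨p, hp, hap⟩ := (Ideal.subset_union_prime_finite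
        ((associatedPrimes.finite R N₁).insert _) (f := id)
        (IsLocalRing.maximalIdeal R • I) 0 fun p hp hp' _ => (hp.resolve_left hp').1).1 h1
      rcases hp with rfl | hp
      · exact hI0 hap
      · refine not_le_of_mem_associatedPrimes (tors_quotient (a := a) (N := N)) hp (ha₁.trans ?_)
        have hp' : p.IsPrime := hp.1
        exact (hp'.radical_le_iff).2 (sup_le hap (Submodule.annihilator_top (R := R) (M := N₁) ▸
          IsAssociatedPrime.annihilator_le hp))
    obtain ⟨j, hj, hjx⟩ : ∃ j ∈ s, I ≤ Ideal.span (s.erase j : Set R) ⊔ Ideal.span {x} := by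
      obtain ⟨f, -, hf⟩ := Submodule.mem_span_finset.1 hxI
      obtain ⟨j, hj, hu⟩ : ∃ j ∈ s, f j ∉ IsLocalRing.maximalIdeal R := by
        by_contra! h
        exact hxm (hf ▸ Submodule.sum_mem _ fun j hj =>
          Submodule.smul_mem_smul (h j hj) (Ideal.subset_span hj))
      refine ⟨j, hj, Ideal.span_le.2 fun t ht => ?_⟩
      by_cases htj : t = j
      · subst htj
        have hu' : IsUnit (f t) := by simpa using hu
        rw [SetLike.mem_coe, ← Ideal.unit_mul_mem_iff_mem _ hu']
        have : f t * t = x - ∑ u ∈ s.erase t, f u • u := by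
          rw [← hf, ← Finset.add_sum_erase s _ hj]; simp
        rw [this]
        refine sub_mem (Submodule.mem_sup_right (Ideal.mem_span_singleton_self x))
          (Submodule.mem_sup_left ?_)
        exact Submodule.sum_mem _ fun u hu => Ideal.mul_mem_left _ _ (Ideal.subset_span hu)
      · exact Submodule.mem_sup_left (Ideal.subset_span (Finset.mem_erase.2 ⟨htj, ht⟩))
    have hxa : x ∈ a := hsa hxI
    have : Subsingleton (Paper.H R a i (QuotSMulTop x N₁)) := by
      refine ih (s.erase j) ?_ ?_ i _ ?_ (by lia)
      · rw [Finset.card_erase_of_mem hj]; lia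
      · exact (Ideal.span_mono (by simp)).trans hsa
      · refine ha₁.trans (Ideal.radical_mono (sup_le (hjx.trans (sup_le_sup_left ?_ _)) ?_))
        · rw [Ideal.span_singleton_le_iff_mem]
          exact mem_annihilator_quotSMulTop x
        · exact le_sup_of_le_right
            (annihilator_le_of_surjective (Submodule.mkQ _) (Submodule.mkQ_surjective _))
    exact subsingleton_of_isSMulRegular hxa hx

end

section

open CategoryTheory Limits Opposite

variable {R : Type} [CommRing R]

/-- Melkersson's criterion. -/
theorem isArtinian_of_isArtinian_ker {G : Type} [AddCommGroup G] [Module R G] (x : R)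
    (hx : ∀ y : G, ∃ k : ℕ, x ^ k • y = 0)
    (h : IsArtinian R (LinearMap.ker (LinearMap.lsmul R G x))) :
    IsArtinian R G := by
  rw [← monotone_stabilizes_iff_artinian]
  intro L
  let K : ℕ → ℕ → Submodule R (LinearMap.ker (LinearMap.lsmul R G x)) := fun j n =>
    Submodule.comap (Submodule.subtype _)
      (Submodule.map (LinearMap.lsmul R G (x ^ n)) (OrderDual.ofDual (L j)))
  have hK : ∀ {j j' n n' : ℕ}, j ≤ j' → n ≤ n' → K j' n' ≤ K j n := by
    rintro j j' n n' hj hn ⟨y, hy⟩ ⟨z, hz, hzy⟩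
    refine ⟨x ^ (n' - n) • z, Submodule.smul_mem _ _ (L.monotone hj hz), ?_⟩
    simp only [LinearMap.lsmul_apply] at hzy ⊢
    rw [← mul_smul, ← pow_add, Nat.add_sub_cancel' hn, hzy]
  have stab : ∀ f : ℕ → Submodule R (LinearMap.ker (LinearMap.lsmul R G x)), Antitone f →
      ∃ n, ∀ m, n ≤ m → f n = f m := fun f hf =>
    IsArtinian.monotone_stabilizes ⟨fun n => OrderDual.toDual (f n), fun _ _ h => hf h⟩
  obtain ⟨m₀, hm₀⟩ := stab (fun j => K j j) fun _ _ h => hK h h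
  choose c hc using fun n => stab (fun j => K j n) fun _ _ h => hK h le_rfl
  obtain ⟨j₀, hj₀, hj₀c⟩ : ∃ j₀, m₀ ≤ j₀ ∧ ∀ n < m₀, c n ≤ j₀ :=
    ⟨max m₀ ((Finset.range m₀).sup c), le_max_left _ _, fun n hn =>
      le_max_of_le_right (Finset.le_sup (Finset.mem_range.2 hn))⟩
  have key : ∀ j, j₀ ≤ j → ∀ n, K j₀ n ≤ K j n := by
    intro j hj n
    rcases lt_or_ge n m₀ with hn | hn
    · exact ((hc n j₀ (hj₀c n hn)).symm.trans (hc n j ((hj₀c n hn).trans hj))).le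
    · exact (hK hj₀ hn).trans ((hm₀ (max j n) (hn.trans (le_max_right _ _))).le.trans
        (hK (le_max_left _ _) (le_max_right _ _)))
  refine ⟨j₀, fun j hj => le_antisymm (L.monotone hj) ?_⟩
  have main : ∀ n, ∀ y ∈ OrderDual.ofDual (L j₀), x ^ n • y = 0 → y ∈ OrderDual.ofDual (L j) := by
    intro n
    induction n with
    | zero => intro y _ hy; simp_all
    | succ n ih =>
      intro y hy hyn
      obtain ⟨z, hz, hzy⟩ := key j hj n (x := ⟨x ^ n • y, by
        rw [LinearMap.mem_ker, LinearMap.lsmul_apply, ← mul_smul, ← pow_succ']; exact hyn⟩)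
          ⟨y, hy, rfl⟩
      have h1 : y - z ∈ OrderDual.ofDual (L j) := by
        refine ih _ (sub_mem hy (L.monotone hj hz)) ?_
        rw [smul_sub, sub_eq_zero]
        exact hzy.symm
      simpa using add_mem h1 hz
  intro y hy
  obtain ⟨k, hk⟩ := hx y
  exact main k y hy hk

/-- A submodule of an Artinian module is either reducible for sums, or every ring element acts
on it surjectively or nilpotently. -/
lemma surjective_or_nilpotent {G : Type} [AddCommGroup G] [Module R G] [IsArtinian R G]
    (L : Submodule R G) (hL : ∀ L₁ < L, ∀ L₂ < L, L₁ ⊔ L₂ ≠ L) (r : R) :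
    (∀ y ∈ L, ∃ z ∈ L, r • z = y) ∨ ∃ n : ℕ, ∀ y ∈ L, r ^ n • y = 0 := by
  obtain ⟨n, hn⟩ := IsArtinian.monotone_stabilizes
    ⟨fun n => OrderDual.toDual (Submodule.map (LinearMap.lsmul R G (r ^ n)) L), by
      rintro n m h _ ⟨y, hy, rfl⟩
      refine ⟨r ^ (m - n) • y, Submodule.smul_mem _ _ hy, ?_⟩
      simp only [LinearMap.lsmul_apply]
      rw [← mul_smul, ← pow_add, Nat.add_sub_cancel' h]⟩
  set L₁ := Submodule.map (LinearMap.lsmul R G (r ^ n)) L with hL₁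
  set L₂ := L ⊓ LinearMap.ker (LinearMap.lsmul R G (r ^ n)) with hL₂
  have h1 : L₁ ≤ L := by
    rintro _ ⟨y, hy, rfl⟩
    exact Submodule.smul_mem _ _ hy
  have hsup : L₁ ⊔ L₂ = L := by
    refine le_antisymm (sup_le h1 inf_le_left) fun y hy => ?_
    have h2 : r ^ n • y ∈ Submodule.map (LinearMap.lsmul R G (r ^ (n + n))) L := by
      have := hn (n + n) (Nat.le_add_left _ _)
      exact (OrderDual.toDual.injective this) ▸ ⟨y, hy, rfl⟩
    obtain ⟨z, hz, hzy⟩ := h2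
    rw [LinearMap.lsmul_apply, pow_add, mul_smul] at hzy
    refine Submodule.mem_sup.2 ⟨r ^ n • z, ⟨z, hz, rfl⟩, y - r ^ n • z,
      ⟨sub_mem hy (Submodule.smul_mem _ _ hz), ?_⟩, by abel⟩
    simp [smul_sub, hzy]
  rcases h1.eq_or_lt with h | h
  · left
    intro y hy
    rcases n with _ | n
    · have h2 : y ∈ Submodule.map (LinearMap.lsmul R G (r ^ 1)) L := by
        have := hn 1 (Nat.zero_le _)
        rw [← (OrderDual.toDual.injective this)]
        exact h.ge hy
      obtain ⟨z, hz, hzy⟩ := h2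
      exact ⟨z, hz, by simpa using hzy⟩
    · obtain ⟨z, hz, hzy⟩ := h ▸ hy
      exact ⟨r ^ n • z, Submodule.smul_mem _ _ hz, by
        rw [← mul_smul, ← pow_succ']; exact hzy⟩
  · right
    have h2 : L₂ = L := by
      by_contra h2
      exact hL _ h _ (lt_of_le_of_ne inf_le_left h2) hsup
    exact ⟨n, fun y hy => (h2 ▸ hy : y ∈ L₂).2⟩

lemma exists_finite_primes_submodule [IsNoetherianRing R] {G : Type} [AddCommGroup G] [Module R G]
    [IsArtinian R G] (m : Ideal R) (L : Submodule R G) :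
    ∃ P : Set (Ideal R), P.Finite ∧ (∀ p ∈ P, p.IsPrime ∧ p ≠ m) ∧
      ∀ r : R, (∀ p ∈ P, r ∉ p) → ∃ j, ∀ t ∈ m ^ j, ∀ y ∈ L, ∃ z ∈ L, r • z = t • y := by
  induction L using IsArtinian.induction with
  | hgt L ih =>
  by_cases hL : ∀ L₁ < L, ∀ L₂ < L, L₁ ⊔ L₂ ≠ L
  · have hsn := surjective_or_nilpotent L hL
    rcases eq_or_ne L ⊥ with rfl | hL0
    · exact ⟨∅, Set.finite_empty, by simp, fun r _ => ⟨0, fun t _ y hy => ⟨0, by simp_all⟩⟩⟩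
    let p : Ideal R := L.annihilator.radical
    have hnil : ∀ r, r ∈ p ↔ ∃ n : ℕ, ∀ y ∈ L, r ^ n • y = 0 := by
      intro r
      simp only [p, Ideal.mem_radical_iff, Submodule.mem_annihilator]
    have hsurj : ∀ r, r ∉ p → ∀ y ∈ L, ∃ z ∈ L, r • z = y := fun r hr =>
      (hsn r).resolve_right fun h => hr ((hnil r).2 h)
    have hp : p.IsPrime := by
      refine ⟨?_, fun {r s} hrs => ?_⟩
      · rw [Ne, Ideal.radical_eq_top, Submodule.annihilator_eq_top_iff]
        exact hL0
      · by_contra! h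
        obtain ⟨n, hn⟩ := (hnil _).1 hrs
        have : ∀ n : ℕ, ∀ y ∈ L, ∃ z ∈ L, (r * s) ^ n • z = y := by
          intro n
          induction n with
          | zero => exact fun y hy => ⟨y, hy, by simp⟩
          | succ n ih =>
            intro y hy
            obtain ⟨z, hz, rfl⟩ := ih y hy
            obtain ⟨w, hw, rfl⟩ := hsurj r h.1 z hz
            obtain ⟨v, hv, rfl⟩ := hsurj s h.2 w hw
            exact ⟨v, hv, by rw [pow_succ, mul_smul, mul_smul]⟩
        refine hL0 (eq_bot_iff.2 fun y hy => ?_)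
        obtain ⟨z, hz, rfl⟩ := this n y hy
        exact hn z hz
    rcases eq_or_ne p m with hpm | hpm
    · obtain ⟨k, hk⟩ := Ideal.exists_pow_le_of_le_radical_of_fg (hpm.ge : m ≤ p)
        (IsNoetherian.noetherian m)
      refine ⟨∅, Set.finite_empty, by simp, fun r _ => ⟨k, fun t ht y hy => ⟨0, zero_mem _, ?_⟩⟩⟩
      rw [smul_zero, Submodule.mem_annihilator.1 (hk ht) y hy]
    · refine ⟨{p}, Set.finite_singleton _, by simpa using ⟨hp, hpm⟩, fun r hr => ⟨0, ?_⟩⟩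
      exact fun t _ y hy => hsurj r (hr p rfl) _ (Submodule.smul_mem _ _ hy)
  · push Not at hL
    obtain ⟨L₁, h₁, L₂, h₂, rfl⟩ := hL
    obtain ⟨P₁, hf₁, hp₁, hr₁⟩ := ih L₁ h₁
    obtain ⟨P₂, hf₂, hp₂, hr₂⟩ := ih L₂ h₂
    refine ⟨P₁ ∪ P₂, hf₁.union hf₂, fun p hp => hp.elim (hp₁ p) (hp₂ p), fun r hr => ?_⟩
    obtain ⟨j₁, hj₁⟩ := hr₁ r fun p hp => hr p (Or.inl hp)
    obtain ⟨j₂, hj₂⟩ := hr₂ r fun p hp => hr p (Or.inr hp)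
    refine ⟨max j₁ j₂, fun t ht y hy => ?_⟩
    obtain ⟨y₁, hy₁, y₂, hy₂, rfl⟩ := Submodule.mem_sup.1 hy
    obtain ⟨z₁, hz₁, h₁⟩ := hj₁ t (Ideal.pow_le_pow_right (le_max_left _ _) ht) y₁ hy₁
    obtain ⟨z₂, hz₂, h₂⟩ := hj₂ t (Ideal.pow_le_pow_right (le_max_right _ _) ht) y₂ hy₂
    exact ⟨z₁ + z₂, Submodule.add_mem_sup hz₁ hz₂, by rw [smul_add, smul_add, h₁, h₂]⟩

lemma isArtinian_of_le_radical_annihilator [IsNoetherianRing R] [IsLocalRing R] {N : Type}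
    [AddCommGroup N] [Module R N] [Module.Finite R N]
    (h : IsLocalRing.maximalIdeal R ≤ (Module.annihilator R N).radical) : IsArtinian R N := by
  let _ := Module.quotientAnnihilator (R := R) (M := N)
  have hd : Ring.KrullDimLE 0 (R ⧸ Module.annihilator R N) := by
    refine Ring.KrullDimLE.mk₀ fun I hI => ?_
    have hle : IsLocalRing.maximalIdeal R ≤ I.comap (Ideal.Quotient.mk _) := by
      refine h.trans ((Ideal.IsPrime.radical_le_iff inferInstance).2 fun r hr => ?_)
      rw [Ideal.mem_comap, Ideal.Quotient.eq_zero_iff_mem.2 hr]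
      exact I.zero_mem
    have hmax : (I.comap (Ideal.Quotient.mk (Module.annihilator R N))).IsMaximal := by
      rw [← (IsLocalRing.maximalIdeal.isMaximal R).eq_of_le
        (Ideal.IsPrime.ne_top inferInstance) hle]
      exact IsLocalRing.maximalIdeal.isMaximal R
    have := Ideal.map_eq_top_or_isMaximal_of_surjective (Ideal.Quotient.mk (Module.annihilator R N))
      Ideal.Quotient.mk_surjective hmax
    rw [Ideal.map_comap_of_surjective _ Ideal.Quotient.mk_surjective] at this
    exact this.resolve_left hI.ne_top
  have hA : IsArtinianRing (R ⧸ Module.annihilator R N) :=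
    IsNoetherianRing.isArtinianRing_of_krullDimLE_zero
  have : IsScalarTower R (R ⧸ Module.annihilator R N) N :=
    (Module.isTorsionBySet_annihilator R N).isScalarTower
  have hF : Module.Finite (R ⧸ Module.annihilator R N) N :=
    Module.Finite.of_restrictScalars_finite R _ _
  have : IsArtinian (R ⧸ Module.annihilator R N) N := isArtinian_of_fg_of_artinian'
  exact isArtinian_of_surjective_algebraMap (S := R) (R := R ⧸ Module.annihilator R N)
    Ideal.Quotient.mk_surjective

variable {a : Ideal R} {N : Type} [AddCommGroup N] [Module R N]

lemma sup_annihilator_le_radical [IsNoetherianRing R] [Module.Finite R N] :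
    a ⊔ Module.annihilator R N ≤ (Module.annihilator R (tors a N)).radical := by
  refine sup_le ?_ ?_
  · obtain ⟨k, hk⟩ := exists_pow_smul_eq_zero_of_fg (a := a) (K := tors a N)
      (IsNoetherian.noetherian _) le_rfl
    exact fun r hr => ⟨k, Module.mem_annihilator.2 fun y =>
      Subtype.ext (hk _ (Ideal.pow_mem_pow hr k) y y.2)⟩
  · exact (LinearMap.annihilator_le_of_injective (tors a N).subtype
      (Submodule.injective_subtype _)).trans Ideal.le_radical

open IsLocalRing in
/-- Local cohomology is Artinian when `a` is primary to the maximal ideal modulo the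
annihilator. -/
theorem isArtinian_lc [IsNoetherianRing R] [IsLocalRing R] :
    ∀ (i : ℕ) (N : Type) [AddCommGroup N] [Module R N] [Module.Finite R N],
      maximalIdeal R ≤ (a ⊔ Module.annihilator R N).radical → IsArtinian R (Paper.H R a i N) := by
  intro i
  induction i with
  | zero =>
    intro N _ _ _ h
    have : IsArtinian R (tors a N) := by
      refine isArtinian_of_le_radical_annihilator (h.trans ?_)
      exact Ideal.radical_le_radical_iff.2 sup_annihilator_le_radical
    have : IsArtinian R (LinearMap.range (ev a N)) := this
    exact isArtinian_of_injective (ev a N).rangeRestrict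
      fun x y h => ev_injective (congrArg Subtype.val h)
  | succ i ih =>
    intro N _ _ _ h
    have hb := lcMap_tors_mkQ_bijective a i N
    obtain ⟨x, hxa, hx⟩ := exists_isSMulRegular (tors_quotient (a := a) (N := N))
    have h1 : IsArtinian R (Paper.H R a i (QuotSMulTop x (N ⧸ tors a N))) := by
      refine ih _ (h.trans (Ideal.radical_mono (sup_le_sup_left ?_ _)))
      exact (annihilator_le_of_surjective (tors a N).mkQ (Submodule.mkQ_surjective _)).trans
        (annihilator_le_of_surjective (Submodule.mkQ _) (Submodule.mkQ_surjective _))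
    obtain ⟨-, δ, -, h2, h3⟩ := lc_exact_regular a hx
    have h4 : IsArtinian R (Paper.H R a (i + 1) (N ⧸ tors a N)) := by
      refine isArtinian_of_isArtinian_ker x (exists_pow_smul_eq_zero_of_mem hxa) ?_
      refine isArtinian_of_surjective _ ((δ i).codRestrict _ (h3 i)) ?_
      rintro ⟨y, hy⟩
      obtain ⟨z, hz⟩ := h2 i y hy
      exact ⟨z, Subtype.ext hz⟩
    exact isArtinian_of_injective _ hb.1

end

section

open CategoryTheory Limits Opposite IsLocalRing

variable {R : Type} [CommRing R] [IsNoetherianRing R] [IsLocalRing R]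
variable {a : Ideal R} {d : ℕ} {N N' : Type} [AddCommGroup N] [Module R N] [Module.Finite R N]
  [AddCommGroup N'] [Module R N'] [Module.Finite R N']

omit [Module.Finite R N'] in
lemma lcMap_surjective_of_surjective (ha : a ≤ maximalIdeal R) (hN : Module.supportDim R N ≤ d)
    (f : N →ₗ[R] N') (hf : Function.Surjective f) : Function.Surjective (lcMap a d f) := by
  obtain ⟨-, δ, h1, -, -, -⟩ := lc_exact a (LinearMap.ker f).subtype f
    (Submodule.injective_subtype _) f.exact_subtype_ker_map hf
  have : Subsingleton (Paper.H R a (d + 1) (LinearMap.ker f)) := by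
    refine subsingleton_of_supportDim_lt ha _ _ (lt_of_le_of_lt
      ((Module.supportDim_le_of_injective _ (Submodule.injective_subtype _)).trans hN) ?_)
    exact_mod_cast Nat.lt_succ_self d
  exact fun y => h1 _ _ (Subsingleton.elim _ _)

omit [Module.Finite R N'] in
/-- The top local cohomology functor is right exact. -/
theorem lcMap_surjective (ha : a ≤ maximalIdeal R) (hN : Module.supportDim R N ≤ d)
    (f : N →ₗ[R] N') [hs : Subsingleton (Paper.H R a d (N' ⧸ LinearMap.range f))] :
    Function.Surjective (lcMap a d f) := by
  obtain ⟨h1, -⟩ := lc_exact a (LinearMap.range f).subtype (LinearMap.range f).mkQ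
    (Submodule.injective_subtype _) (LinearMap.exact_subtype_mkQ _) (Submodule.mkQ_surjective _)
  intro y
  obtain ⟨z, rfl⟩ := h1 d y (Subsingleton.elim _ _)
  obtain ⟨w, rfl⟩ := lcMap_surjective_of_surjective ha hN f.rangeRestrict
    f.surjective_rangeRestrict z
  exact ⟨w, by rw [← lcMap_comp]; rfl⟩

open Pointwise in
lemma smul_surjective (ha : a ≤ maximalIdeal R) (hN : Module.supportDim R N ≤ d) (r : R)
    [hs : Subsingleton (Paper.H R a d (QuotSMulTop r N))] (y : Paper.H R a d N) :
    ∃ z : Paper.H R a d N, r • z = y := by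
  have h : r • (⊤ : Submodule R N) = LinearMap.range (LinearMap.lsmul R N r) := by
    ext n
    simp [Submodule.mem_smul_pointwise_iff_exists]
  have : Subsingleton (Paper.H R a d (N ⧸ LinearMap.range (LinearMap.lsmul R N r))) := h ▸ hs
  obtain ⟨z, hz⟩ := lcMap_surjective ha hN (LinearMap.lsmul R N r) y
  exact ⟨z, by rwa [lcMap_lsmul] at hz⟩

omit [Module.Finite R N] [Module.Finite R N'] [IsLocalRing R] [IsNoetherianRing R] in
lemma lcMap_eq_zero {i : ℕ} (f : N →ₗ[R] N') [Subsingleton (Paper.H R a i (LinearMap.range f))]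
    (y : Paper.H R a i N) : lcMap a i f y = 0 := by
  have : f = (LinearMap.range f).subtype ∘ₗ f.rangeRestrict := rfl
  rw [this, lcMap_comp, Subsingleton.elim (lcMap a i f.rangeRestrict y) 0, map_zero]

omit [IsNoetherianRing R] [IsLocalRing R] in
lemma le_supportDim_iff {n : ℕ} : n ≤ Module.supportDim R N ↔
    ∃ l : LTSeries (PrimeSpectrum R), l.length = n ∧ Module.annihilator R N ≤ l.head.asIdeal := by
  rw [Module.supportDim, Order.le_krullDim_iff]
  constructor
  · rintro ⟨l, hl⟩
    exact ⟨l.map Subtype.val fun _ _ h => h, hl, Module.mem_support_iff_of_finite.1 l.head.2⟩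
  · rintro ⟨l, hl, h⟩
    exact ⟨⟨l.length, fun j => ⟨l j, Module.mem_support_iff_of_finite.2
      (h.trans (LTSeries.head_le l j))⟩, fun j => l.step j⟩, hl⟩

lemma cast_le_of_add_one_le {x : WithBot ℕ∞} {n : ℕ} (h : (n + 1 : ℕ) ≤ x + 1) : n ≤ x := by
  induction x with
  | bot => simp at h
  | coe x =>
    induction x with
    | top => simp
    | coe x => norm_cast at *; lia

lemma le_cast_of_add_one_le {x : WithBot ℕ∞} {n : ℕ} (h : x + 1 ≤ (n + 1 : ℕ)) : x ≤ n := by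
  induction x with
  | bot => simp
  | coe x =>
    induction x with
    | top => norm_cast at h
    | coe x => norm_cast at *; lia

lemma lt_cast_of_add_one_le {x : WithBot ℕ∞} {n : ℕ} (h : x + 1 ≤ n) : x < n := by
  induction x with
  | bot => simp
  | coe x =>
    induction x with
    | top => norm_cast at h
    | coe x => norm_cast at *

lemma exists_notMem_minimalPrimes (hN : 1 ≤ Module.supportDim R N) :
    ∃ x ∈ maximalIdeal R, ∀ p ∈ (Module.annihilator R N).minimalPrimes, x ∉ p := by
  by_contra! h
  obtain ⟨p, hp, hmp⟩ := (Ideal.subset_union_prime_finite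
    (Ideal.finite_minimalPrimes_of_isNoetherianRing R (Module.annihilator R N)) (f := id)
    0 0 fun p hp _ _ => hp.1.1).1 (fun x hx => Set.mem_iUnion₂.2 (by
      obtain ⟨p, hp, hxp⟩ := h x hx
      exact ⟨p, hp, hxp⟩))
  obtain ⟨l, hl, hann⟩ := le_supportDim_iff (n := 1).1 (by exact_mod_cast hN)
  have h1 := hp.2 ⟨l.head.2, hann⟩ ((le_maximalIdeal l.head.2.ne_top).trans hmp)
  have h2 : l.head < l.last := l.strictMono (Fin.lt_def.2 (by simp [hl]))
  exact h2.not_ge ((le_maximalIdeal l.last.2.ne_top).trans (hmp.trans h1))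

/-- Top local cohomology is nonzero for ideals primary to the maximal ideal modulo the
annihilator. -/
theorem nontrivial_lc (ha : a ≤ maximalIdeal R) :
    ∀ (n : ℕ) (N : Type) [AddCommGroup N] [Module R N] [Module.Finite R N],
      Module.supportDim R N = n → maximalIdeal R ≤ (a ⊔ Module.annihilator R N).radical →
      ¬ Subsingleton (Paper.H R a n N) := by
  intro n
  induction n with
  | zero =>
    intro N _ _ _ hN h hs
    have h0 : tors a N = ⊤ := by
      have h1 := support_of_supportDim_eq_zero R N hN
      refine tors_eq_top_of_le_radical (ha.trans ?_)
      rw [Module.support_eq_zeroLocus] at h1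
      rw [← PrimeSpectrum.vanishingIdeal_zeroLocus_eq_radical, h1,
        PrimeSpectrum.vanishingIdeal_zeroLocus_eq_radical]
      exact Ideal.le_radical
    have : Subsingleton N := by
      refine subsingleton_of_forall_eq 0 fun y => ?_
      obtain ⟨y, rfl⟩ : y ∈ tors a N := h0 ▸ Submodule.mem_top
      rw [Subsingleton.elim y 0, map_zero]
    rw [Module.supportDim_eq_bot_of_subsingleton] at hN
    exact absurd hN (by simp)
  | succ n ih =>
    intro N _ _ _ hN h hs
    set N₁ := N ⧸ tors a N with hN₁
    have hT := tors_quotient (a := a) (N := N)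
    have hs₁ : Subsingleton (Paper.H R a (n + 1) N₁) :=
      (lcMap_tors_mkQ_bijective a n N).2.subsingleton
    have hann := annihilator_le_of_surjective (tors a N).mkQ (Submodule.mkQ_surjective _)
    have hd : Module.supportDim R N₁ = (n + 1 : ℕ) := by
      refine le_antisymm ((Module.supportDim_le_of_surjective (tors a N).mkQ
        (Submodule.mkQ_surjective _)).trans hN.le) ?_
      obtain ⟨l, hl, hlN⟩ := le_supportDim_iff.1 hN.ge
      refine le_supportDim_iff.2 ⟨l, hl, ?_⟩
      have hlt : l.head < l.last := l.strictMono (Fin.lt_def.2 (by simp [hl]))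
      have h0 : l.head ∈ Module.support R N := Module.mem_support_iff_of_finite.2 hlN
      rw [Module.support_of_exact (LinearMap.exact_subtype_mkQ (tors a N))
        (Submodule.injective_subtype _) (Submodule.mkQ_surjective _)] at h0
      refine Module.mem_support_iff_of_finite.1 (h0.resolve_left fun h1 => ?_)
      have h2 : maximalIdeal R ≤ l.head.asIdeal := h.trans
        ((Ideal.radical_le_radical_iff.2 sup_annihilator_le_radical).trans
          (l.head.2.radical_le_iff.2 (Module.mem_support_iff_of_finite.1 h1)))
      exact hlt.not_ge ((le_maximalIdeal l.last.2.ne_top).trans h2)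
    have hart : IsArtinian R (Paper.H R a n N₁) :=
      isArtinian_lc n N₁ (h.trans (Ideal.radical_mono (sup_le_sup_left hann _)))
    obtain ⟨P, hPf, hP, hPr⟩ := exists_finite_primes_submodule (maximalIdeal R)
      (⊤ : Submodule R (Paper.H R a n N₁))
    obtain ⟨r, hrm, hrP, hr⟩ : ∃ r ∈ maximalIdeal R, (∀ p ∈ P, r ∉ p) ∧ IsSMulRegular N₁ r := by
      by_contra! hc
      have h1 : (maximalIdeal R : Set R) ⊆ ⋃ p ∈ P ∪ associatedPrimes R N₁, (p : Set R) := by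
        rw [Set.biUnion_union, biUnion_associatedPrimes_eq_compl_regular]
        intro x hx
        by_cases hxP : ∀ p ∈ P, x ∉ p
        · exact Or.inr (hc x hx hxP)
        · push Not at hxP
          exact Or.inl (by simpa using hxP)
      obtain ⟨p, hp, hmp⟩ := (Ideal.subset_union_prime_finite
        (hPf.union (associatedPrimes.finite R N₁)) (f := id) 0 0
        fun p hp _ _ => hp.elim (fun hp => (hP p hp).1) fun hp => hp.1).1 h1
      rcases hp with hp | hp
      · exact (hP p hp).2 (((maximalIdeal.isMaximal R).eq_of_le (hP p hp).1.ne_top hmp).symm)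
      · exact not_le_of_mem_associatedPrimes hT hp (ha.trans hmp)
    obtain ⟨j, hj⟩ := hPr r hrP
    set N₂ := QuotSMulTop r N₁
    have hd₂ : Module.supportDim R N₂ = n := by
      have := Module.supportDim_quotSMulTop_succ_eq_supportDim hr hrm
      rw [hd] at this
      exact le_antisymm (le_cast_of_add_one_le this.le) (cast_le_of_add_one_le this.ge)
    have hann₂ : maximalIdeal R ≤ (a ⊔ Module.annihilator R N₂).radical :=
      h.trans (Ideal.radical_mono (sup_le_sup_left (hann.trans
        (annihilator_le_of_surjective (Submodule.mkQ _) (Submodule.mkQ_surjective _))) _))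
    have hnt := ih N₂ hd₂ hann₂
    obtain ⟨-, δ, h1, -, -⟩ := lc_exact_regular a hr
    have hsurj : ∀ y : Paper.H R a n N₂, ∃ z, lcMap a n (Submodule.mkQ _) z = y := fun y =>
      h1 n y (Subsingleton.elim _ _)
    have hz : ∀ t ∈ maximalIdeal R ^ j, ∀ y : Paper.H R a n N₂, t • y = 0 := by
      intro t ht y
      obtain ⟨z, rfl⟩ := hsurj y
      obtain ⟨w, -, hw⟩ := hj t ht z trivial
      rw [← map_smul, ← hw, map_smul, ← lcMap_lsmul]
      have : LinearMap.lsmul R N₂ r = 0 := by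
        refine LinearMap.ext fun v => ?_
        exact Module.mem_annihilator.1 (mem_annihilator_quotSMulTop r) v
      rw [this, lcMap_zero]
    rcases n with _ | n
    · refine hnt (subsingleton_of_forall_eq 0 fun y => ?_)
      obtain ⟨z, rfl⟩ := hsurj y
      have : z = 0 := by
        apply ev_injective
        rw [map_zero, ← Submodule.mem_bot R, ← hT]
        exact ⟨z, rfl⟩
      rw [this, map_zero]
    · have hnN₂ : Nontrivial N₂ := by
        rw [← Module.supportDim_ne_bot_iff_nontrivial R, hd₂]
        simp
      obtain ⟨s, hsm, hs⟩ := exists_notMem_minimalPrimes (R := R) (N := N₂) (by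
        rw [hd₂]; exact_mod_cast Nat.succ_le_succ n.zero_le)
      have h2 := Module.supportDim_quotSMulTop_succ_le_of_notMem_minimalPrimes hs
      have h3 : Subsingleton (Paper.H R a (n + 1) (QuotSMulTop s N₂)) := by
        refine subsingleton_of_supportDim_lt ha _ _ (lt_cast_of_add_one_le (h2.trans hd₂.le))
      have h4 : ∀ k, ∀ y : Paper.H R a (n + 1) N₂, ∃ z : Paper.H R a (n + 1) N₂, s ^ k • z = y := by
        intro k
        induction k with
        | zero => exact fun y => ⟨y, by simp⟩
        | succ k ihk =>
          intro y
          obtain ⟨z, rfl⟩ := ihk y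
          obtain ⟨w, rfl⟩ := smul_surjective ha hd₂.le s z
          exact ⟨w, by rw [pow_succ, mul_smul]⟩
      refine hnt (subsingleton_of_forall_eq 0 fun y => ?_)
      obtain ⟨z, rfl⟩ := h4 j y
      exact hz _ (Ideal.pow_mem_pow hsm j) z

end

section

open CategoryTheory Limits Opposite IsLocalRing

section AttachedPrimes
variable {R : Type} [CommRing R] {F : Type} [AddCommGroup F] [Module R F]

lemma isSecondaryFor_range {p : Ideal R} (hp : p.IsPrime) {g : R}
    (h1 : ∀ r ∈ p, ∃ k : ℕ, ∀ y : F, (r ^ k * g) • y = 0)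
    (h2 : ∀ r ∉ p, ∀ y : F, ∃ z : F, (r * g) • z = g • y) (h0 : ∃ y : F, g • y ≠ 0) :
    Paper.IsSecondaryFor R (LinearMap.range (LinearMap.lsmul R F g)) p := by
  obtain ⟨y₀, hy₀⟩ := h0
  refine ⟨fun h => hy₀ ?_, fun r => ?_, ?_⟩
  · rw [← Submodule.mem_bot R, ← h]
    exact ⟨y₀, rfl⟩
  · by_cases hr : r ∈ p
    · obtain ⟨k, hk⟩ := h1 r hr
      refine Or.inr ⟨k, ?_⟩
      rintro _ ⟨y, rfl⟩
      simpa [mul_smul] using hk y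
    · refine Or.inl ?_
      rintro _ ⟨y, rfl⟩
      obtain ⟨z, hz⟩ := h2 r hr y
      exact ⟨g • z, ⟨z, rfl⟩, by rw [← mul_smul, hz]; rfl⟩
  · ext r
    constructor
    · rintro ⟨k, hk⟩
      by_contra hr
      obtain ⟨z, hz⟩ := h2 (r ^ k) (fun h => hr (hp.mem_of_pow_mem k h)) y₀
      apply hy₀
      rw [← hz, mul_smul]
      exact Submodule.mem_annihilator.1 hk _ ⟨z, rfl⟩
    · intro hr
      obtain ⟨k, hk⟩ := h1 r hr
      refine ⟨k, Submodule.mem_annihilator.2 ?_⟩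
      rintro _ ⟨y, rfl⟩
      simpa [mul_smul] using hk y

lemma eq_of_smul_notMem {p : Ideal R} (hp : p.IsPrime) {g : R}
    (h1 : ∀ r ∈ p, ∃ k : ℕ, ∀ y : F, (r ^ k * g) • y = 0)
    (h2 : ∀ r ∉ p, ∀ y : F, ∃ z : F, (r * g) • z = g • y)
    {S W : Submodule R F} {q : Ideal R} (hS : Paper.IsSecondaryFor R S q) (hSW : S ⊔ W = ⊤)
    {y : F} (hy : g • y ∉ W) : p = q := by
  obtain ⟨-, hr, rfl⟩ := hS
  refine le_antisymm (fun r hrp => ?_) (fun r hrq => ?_)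
  · by_contra hrq
    have hsurj : ∀ k : ℕ, ∀ m ∈ S, ∃ n ∈ S, r ^ k • n = m := by
      have h := (hr r).resolve_right fun ⟨k, hk⟩ => hrq ⟨k, Submodule.mem_annihilator.2 hk⟩
      intro k
      induction k with
      | zero => exact fun m hm => ⟨m, hm, by simp⟩
      | succ k ih =>
        intro m hm
        obtain ⟨n, hn, rfl⟩ := ih m hm
        obtain ⟨n', hn', rfl⟩ := h n hn
        exact ⟨n', hn', by rw [pow_succ, mul_smul]⟩
    obtain ⟨k, hk⟩ := h1 r hrp
    obtain ⟨s, hs, w, hw, rfl⟩ := Submodule.mem_sup.1 (hSW ▸ Submodule.mem_top : y ∈ S ⊔ W)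
    obtain ⟨s, hs, rfl⟩ := hsurj k s hs
    apply hy
    rw [smul_add, ← mul_smul, mul_comm, hk, zero_add]
    exact W.smul_mem _ hw
  · by_contra hrp
    obtain ⟨k, hk⟩ := hrq
    obtain ⟨z, hz⟩ := h2 (r ^ k) (fun h => hrp (hp.mem_of_pow_mem k h)) y
    obtain ⟨s, hs, w, hw, rfl⟩ := Submodule.mem_sup.1 (hSW ▸ Submodule.mem_top : z ∈ S ⊔ W)
    apply hy
    rw [← hz, smul_add, mul_comm, mul_smul, Submodule.mem_annihilator.1 hk s hs, smul_zero,
      zero_add]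
    exact W.smul_mem _ hw

/-- If multiplications by elements `g p` split `F` into secondary pieces, the attached primes of
`F` are those `p` for which the piece `g p • F` is nonzero. -/
theorem attached_eq {A : Set (Ideal R)} (hA : A.Finite) (hprime : ∀ p ∈ A, p.IsPrime)
    {g : Ideal R → R} (hg : ∀ p ∈ A, g p ∉ p)
    (h1 : ∀ p ∈ A, ∀ r ∈ p, ∃ k : ℕ, ∀ y : F, (r ^ k * g p) • y = 0)
    (h2 : ∀ p ∈ A, ∀ r ∉ p, ∀ y : F, ∃ z : F, (r * g p) • z = g p • y)
    (h3 : ∀ p ∈ A, ∀ q ∈ A, p ≠ q → ∀ y : F, (g p * g q) • y = 0)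
    (h4 : ∀ W : Submodule R F, (∀ p ∈ A, ∀ y : F, g p • y ∈ W) → W = ⊤) :
    Paper.attached R F = {p ∈ A | ∃ y : F, g p • y ≠ 0} := by
  ext q
  constructor
  · rintro ⟨rep, i, rfl⟩
    set W : Submodule R F := ⨆ j ∈ ({i}ᶜ : Set (Fin rep.n)), rep.S j with hW
    have hSW : rep.S i ⊔ W = ⊤ := by
      rw [eq_top_iff, ← rep.sum]
      refine iSup_le fun j => ?_
      by_cases hj : j = i
      · exact hj ▸ le_sup_left
      · exact le_sup_of_le_right (le_iSup₂_of_le j hj le_rfl)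
    have hWt : ∃ p ∈ A, ∃ y : F, g p • y ∉ W := by
      by_contra! h
      exact rep.irred i (le_top.trans (h4 W h).ge)
    obtain ⟨p, hp, y, hy⟩ := hWt
    obtain rfl := eq_of_smul_notMem (hprime p hp) (h1 p hp) (h2 p hp) (rep.sec i) hSW hy
    exact ⟨hp, y, fun h => hy (h ▸ W.zero_mem)⟩
  · intro hq
    set A' := {p ∈ A | ∃ y : F, g p • y ≠ 0}
    have : Finite A' := hA.subset (Set.sep_subset _ _)
    obtain ⟨n, ⟨e⟩⟩ := Finite.exists_equiv_fin A'
    refine ⟨⟨n, fun i => LinearMap.range (LinearMap.lsmul R F (g (e.symm i))), fun i => e.symm i,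
      fun i => hprime _ (e.symm i).2.1, fun i => isSecondaryFor_range (hprime _ (e.symm i).2.1)
        (h1 _ (e.symm i).2.1) (h2 _ (e.symm i).2.1) (e.symm i).2.2, h4 _ fun p hp y => ?_,
      Subtype.val_injective.comp e.symm.injective, fun j hj => ?_⟩, e ⟨q, hq⟩, by simp⟩
    · by_cases hy : g p • y = 0
      · rw [hy]
        exact Submodule.zero_mem _
      · exact Submodule.mem_iSup_of_mem (e ⟨p, hp, y, hy⟩) ⟨y, by simp⟩
    · obtain ⟨y, hy⟩ := (e.symm j).2.2
      obtain ⟨z, hz⟩ := h2 _ (e.symm j).2.1 _ (hg _ (e.symm j).2.1) y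
      apply hy
      rw [← hz, mul_smul]
      have h5 : (⨆ i ∈ ({j}ᶜ : Set (Fin n)),
          LinearMap.range (LinearMap.lsmul R F (g (e.symm i)))) ≤
          LinearMap.ker (LinearMap.lsmul R F (g (e.symm j))) := by
        refine iSup₂_le fun i hi => ?_
        rintro _ ⟨y, rfl⟩
        simpa only [LinearMap.mem_ker, LinearMap.lsmul_apply, mul_smul] using
          h3 _ (e.symm j).2.1 _ (e.symm i).2.1
          (fun h => hi (e.symm.injective (Subtype.ext h)).symm) y
      exact h5 (hj ⟨z, rfl⟩)

end AttachedPrimes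

section Components
variable {R : Type} [CommRing R]

lemma exists_mul_pow_mem_of_mem_minimalPrimes {I p : Ideal R} (hp : p ∈ I.minimalPrimes) {t : R}
    (ht : t ∈ p) : ∃ u ∉ p, ∃ k : ℕ, u * t ^ k ∈ I := by
  by_contra! h
  have := hp.1.1
  obtain ⟨q, hq, hIq, hqS⟩ := Ideal.exists_le_prime_disjoint I (p.primeCompl ⊔ Submonoid.powers t)
    (Set.disjoint_left.2 fun x hxI hx => by
      obtain ⟨u, hu, _, ⟨k, rfl⟩, rfl⟩ := Submonoid.mem_sup.1 hx
      exact h u hu k hxI)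
  refine Set.disjoint_left.1 hqS (hp.2 ⟨hq, hIq⟩ (fun x hx => ?_) ht)
    ((le_sup_right : Submonoid.powers t ≤ _) (Submonoid.mem_powers t))
  by_contra hxp
  exact Set.disjoint_left.1 hqS hx ((le_sup_left : p.primeCompl ≤ _) hxp)

/-- Elements which cut out the components belonging to a finite set of minimal primes. -/
lemma exists_component_elements {I : Ideal R} {A : Set (Ideal R)} (hA : A.Finite)
    (hAI : A ⊆ I.minimalPrimes) : ∃ g : Ideal R → R, ∀ p ∈ A, g p ∉ p ∧
      ∀ q ∈ A, q ≠ p → ∃ u ∉ q, u * g p ∈ I := by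
  classical
  have h : ∀ p ∈ A, ∀ q ∈ A, q ≠ p → ∃ t ∉ p, ∃ u ∉ q, u * t ∈ I := by
    intro p hp q hq hqp
    have h1 : ¬ q ≤ p := fun h => hqp (le_antisymm h ((hAI hp).2 (hAI hq).1 h))
    obtain ⟨t, htq, htp⟩ := SetLike.not_le_iff_exists.1 h1
    obtain ⟨u, hu, k, hk⟩ := exists_mul_pow_mem_of_mem_minimalPrimes (hAI hq) htq
    exact ⟨t ^ k, fun h => htp ((hAI hp).1.1.mem_of_pow_mem k h), u, hu, hk⟩
  choose! t ht u hu hut using h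
  refine ⟨fun p => ∏ q ∈ hA.toFinset.erase p, t p q, fun p hp => ⟨fun h => ?_, fun q hq hqp =>
    ⟨u p q, hu p hp q hq hqp, ?_⟩⟩⟩
  · have := (hAI hp).1.1
    obtain ⟨q, hq, hqt⟩ := (Ideal.IsPrime.prod_mem_iff).1 h
    rw [Finset.mem_erase, Set.Finite.mem_toFinset] at hq
    exact ht p hp q hq.2 hq.1 hqt
  · have hq' : q ∈ hA.toFinset.erase p := by simp [hq, hqp]
    exact I.mem_of_dvd (mul_dvd_mul_left _ (Finset.dvd_prod_of_mem _ hq')) (hut p hp q hq hqp)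

end Components

section Dimension
variable {R : Type} [CommRing R]
variable {M K : Type} [AddCommGroup M] [Module R M] [Module.Finite R M]
  [AddCommGroup K] [Module R K] [Module.Finite R K]

lemma supportDim_eq_dimMod : Module.supportDim R M = Paper.dimMod R M := by
  let e : Module.support R M ≃o {p : Ideal R // p.IsPrime ∧ Module.annihilator R M ≤ p} :=
    { toFun := fun p => ⟨p.1.asIdeal, p.1.2, Module.mem_support_iff_of_finite.1 p.2⟩
      invFun := fun p => ⟨⟨p.1, p.2.1⟩, Module.mem_support_iff_of_finite.2 p.2.2⟩
      left_inv := fun _ => rfl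
      right_inv := fun _ => rfl
      map_rel_iff' := Iff.rfl }
  exact Order.krullDim_eq_of_orderIso e

lemma le_coheight_iff {I : Ideal R} {n : ℕ} : n ≤ Paper.coheight R I ↔
    ∃ l : LTSeries (PrimeSpectrum R), l.length = n ∧ I ≤ l.head.asIdeal := by
  have h := le_supportDim_iff (R := R) (N := R ⧸ I) (n := n)
  rwa [supportDim_eq_dimMod, Paper.dimMod, Ideal.annihilator_quotient] at h

lemma coheight_anti {I J : Ideal R} (h : I ≤ J) : Paper.coheight R J ≤ Paper.coheight R I :=
  Order.krullDim_le_of_strictMono (fun p => ⟨p.1, p.2.1, h.trans p.2.2⟩) fun _ _ hpq => hpq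

omit [Module.Finite R M] in
lemma mem_assh_of_le {d : ℕ} (hM : Paper.dimMod R M = d) {p : Ideal R} (hp : p.IsPrime)
    (hle : Module.annihilator R M ≤ p) (h : d ≤ Paper.coheight R p) : p ∈ Paper.assh R M :=
  ⟨⟨hp, hle⟩, le_antisymm (coheight_anti hle) (hM ▸ h)⟩

omit [Module.Finite R M] in
lemma assh_subset_minimalPrimes {d : ℕ} (hM : Paper.dimMod R M = d) :
    Paper.assh R M ⊆ (Module.annihilator R M).minimalPrimes := by
  rintro q ⟨⟨hq, hMq⟩, hqd⟩
  refine ⟨⟨hq, hMq⟩, fun p ⟨hp, hMp⟩ hpq => ?_⟩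
  by_contra hqp
  obtain ⟨l, hl, hql⟩ := le_coheight_iff.1 (hqd.trans hM).ge
  have h : ((d + 1 : ℕ) : WithBot ℕ∞) ≤ Paper.dimMod R M := le_coheight_iff.2
    ⟨l.cons ⟨p, hp⟩ (lt_of_lt_of_le (lt_of_le_not_ge hpq hqp : p < q) hql), by simp [hl],
      by simpa using hMp⟩
  rw [hM] at h
  exact absurd (Nat.cast_le.1 h) (by lia)

omit [Module.Finite R M] in
lemma supportDim_lt {d : ℕ} (hM : Paper.dimMod R M = d)
    (hann : Module.annihilator R M ≤ Module.annihilator R K)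
    (h : ∀ p ∈ Paper.assh R M, ∃ u ∉ p, u ∈ Module.annihilator R K) :
    Module.supportDim R K < d := by
  by_contra! hd
  obtain ⟨l, hl, hKl⟩ := le_supportDim_iff.1 hd
  obtain ⟨u, hu, hu'⟩ := h _ (mem_assh_of_le hM l.head.2 (hann.trans hKl)
    (le_coheight_iff.2 ⟨l, hl, le_rfl⟩))
  exact hu (hKl hu')

end Dimension

section TopCohomology
variable {R : Type} [CommRing R] [IsNoetherianRing R] [IsLocalRing R]
variable {a : Ideal R} {d : ℕ} {M : Type} [AddCommGroup M] [Module R M] [Module.Finite R M]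

lemma smul_eq_zero (ha : a ≤ maximalIdeal R) (hM : Paper.dimMod R M = d) {c : R}
    (hc : ∀ p ∈ Paper.assh R M, ∃ u ∉ p, u * c ∈ Module.annihilator R M)
    (y : Paper.H R a d M) : c • y = 0 := by
  rw [← lcMap_lsmul]
  have : Subsingleton (Paper.H R a d (LinearMap.range (LinearMap.lsmul R M c))) := by
    refine subsingleton_of_supportDim_lt ha _ _ (supportDim_lt hM
      (annihilator_le_of_surjective _ (LinearMap.surjective_rangeRestrict _)) fun p hp => ?_)
    obtain ⟨u, hu, huc⟩ := hc p hp
    refine ⟨u, hu, Module.mem_annihilator.2 ?_⟩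
    rintro ⟨_, y, rfl⟩
    refine Subtype.ext ?_
    simpa [mul_smul] using Module.mem_annihilator.1 huc y
  exact lcMap_eq_zero _ y

lemma exists_smul_eq (ha : a ≤ maximalIdeal R) (hM : Paper.dimMod R M = d) {h : R}
    (hh : ∀ p ∈ Paper.assh R M, h ∉ p) (y : Paper.H R a d M) :
    ∃ z : Paper.H R a d M, h • z = y := by
  have : Subsingleton (Paper.H R a d (QuotSMulTop h M)) :=
    subsingleton_of_supportDim_lt ha _ _ (supportDim_lt hM
      (annihilator_le_of_surjective (Submodule.mkQ _) (Submodule.mkQ_surjective _))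
      fun p hp => ⟨h, hh p hp, mem_annihilator_quotSMulTop h⟩)
  exact smul_surjective ha (supportDim_eq_dimMod.trans hM).le h y

omit [IsNoetherianRing R] [IsLocalRing R] in
lemma sum_notMem {A : Set (Ideal R)} (hA : A.Finite) {I : Ideal R} {g : Ideal R → R}
    (hp : ∀ p ∈ A, p.IsPrime) (hI : ∀ p ∈ A, I ≤ p)
    (hg : ∀ p ∈ A, g p ∉ p ∧ ∀ q ∈ A, q ≠ p → ∃ u ∉ q, u * g p ∈ I)
    {c : Ideal R → R} (hc : ∀ p ∈ A, c p ∉ p) : ∀ p ∈ A, ∑ q ∈ hA.toFinset, c q * g q ∉ p := by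
  classical
  intro p hpA hmem
  have := hp p hpA
  have hpA' : p ∈ hA.toFinset := by simpa
  rw [← Finset.add_sum_erase _ _ hpA'] at hmem
  refine (this.mul_mem_iff_mem_or_mem.1 ((Ideal.add_mem_iff_left p
    (Ideal.sum_mem p fun q hq => ?_)).1 hmem)).elim (hc p hpA) (hg p hpA).1
  rw [Finset.mem_erase, Set.Finite.mem_toFinset] at hq
  obtain ⟨u, hu, hug⟩ := (hg q hq.2).2 p hpA hq.1.symm
  exact p.mul_mem_left _ ((this.mem_or_mem (hI p hpA hug)).resolve_left hu)

/-- The attached primes of the top local cohomology module are the primes of `Assh M` whose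
component survives. -/
theorem attached_lc (ha : a ≤ maximalIdeal R) (hM : Paper.dimMod R M = d) {g : Ideal R → R}
    (hg : ∀ p ∈ Paper.assh R M, g p ∉ p ∧
      ∀ q ∈ Paper.assh R M, q ≠ p → ∃ u ∉ q, u * g p ∈ Module.annihilator R M) :
    Paper.attached R (Paper.H R a d M) =
      {p ∈ Paper.assh R M | ∃ y : Paper.H R a d M, g p • y ≠ 0} := by
  classical
  have hmin := assh_subset_minimalPrimes hM
  have hfin : (Paper.assh R M).Finite :=
    (Ideal.finite_minimalPrimes_of_isNoetherianRing R _).subset hmin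
  have hprime : ∀ p ∈ Paper.assh R M, p.IsPrime := fun p hp => hp.1.1
  have h3 : ∀ p ∈ Paper.assh R M, ∀ q ∈ Paper.assh R M, p ≠ q →
      ∀ y : Paper.H R a d M, (g p * g q) • y = 0 := by
    intro p hp q hq hpq y
    refine smul_eq_zero ha hM (fun s hs => ?_) y
    by_cases hsp : s = p
    · obtain ⟨u, hu, hug⟩ := (hg q hq).2 s hs (hsp ▸ hpq)
      exact ⟨u, hu, Ideal.mem_of_dvd _ (mul_dvd_mul_left _ (dvd_mul_left _ _)) hug⟩
    · obtain ⟨u, hu, hug⟩ := (hg p hp).2 s hs hsp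
      exact ⟨u, hu, Ideal.mem_of_dvd _ (mul_dvd_mul_left _ (dvd_mul_right _ _)) hug⟩
  refine attached_eq hfin hprime (fun p hp => (hg p hp).1) (fun p hp r hr => ?_)
    (fun p hp r hr y => ?_) h3 (fun W hW => ?_)
  · obtain ⟨u, hu, k, huk⟩ := exists_mul_pow_mem_of_mem_minimalPrimes (hmin hp) hr
    refine ⟨k, smul_eq_zero ha hM fun s hs => ?_⟩
    by_cases hsp : s = p
    · subst hsp
      exact ⟨u, hu, Ideal.mem_of_dvd _ (mul_dvd_mul_left _ (dvd_mul_right _ _)) huk⟩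
    · obtain ⟨u, hu, hug⟩ := (hg p hp).2 s hs hsp
      exact ⟨u, hu, Ideal.mem_of_dvd _ (mul_dvd_mul_left _ (dvd_mul_left _ _)) hug⟩
  · have hc : ∀ q ∈ Paper.assh R M, (if q = p then r else 1) ∉ q := by
      intro q hq
      split_ifs with h
      · exact h ▸ hr
      · exact (Ideal.ne_top_iff_one q).1 (hprime q hq).ne_top
    obtain ⟨z, rfl⟩ := exists_smul_eq ha hM
      (sum_notMem hfin hprime (fun q hq => hq.1.2) hg hc) y
    refine ⟨g p • z, ?_⟩
    rw [Finset.sum_smul, Finset.smul_sum, Finset.sum_eq_single p]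
    · rw [if_pos rfl, smul_smul, smul_smul]
      congr 1
      ring
    · intro q hq hqp
      rw [if_neg hqp, one_mul, smul_smul]
      exact h3 p hp q (by simpa using hq) hqp.symm z
    · intro h
      exact absurd hp (by simpa using h)
  · refine eq_top_iff.2 fun y _ => ?_
    obtain ⟨z, rfl⟩ := exists_smul_eq ha hM
      (sum_notMem hfin hprime (fun q hq => hq.1.2) hg (c := fun _ => 1)
        fun q hq => (Ideal.ne_top_iff_one q).1 (hprime q hq).ne_top) y
    rw [Finset.sum_smul]
    refine W.sum_mem fun q hq => ?_
    rw [one_mul]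
    exact hW q (by simpa using hq) z

end TopCohomology

end

section

open CategoryTheory Limits Opposite IsLocalRing

section Survival
variable {R : Type} [CommRing R] [IsNoetherianRing R] [IsLocalRing R]
variable {a : Ideal R} {d : ℕ} {M : Type} [AddCommGroup M] [Module R M] [Module.Finite R M]

lemma component_eq_zero (ha : a ≤ maximalIdeal R) (hM : Paper.dimMod R M = d) {q : Ideal R}
    (hq : q ∈ Paper.assh R M) {g : R}
    (hg : ∀ p ∈ Paper.assh R M, p ≠ q → ∃ u ∉ p, u * g ∈ Module.annihilator R M) {x : R}
    (hx : x ∈ q) [Subsingleton (Paper.H R a d (QuotSMulTop x M))] (y : Paper.H R a d M) :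
    g • y = 0 := by
  obtain ⟨u, hu, k, huk⟩ :=
    exists_mul_pow_mem_of_mem_minimalPrimes (assh_subset_minimalPrimes hM hq) hx
  have hsurj : ∀ j : ℕ, ∃ z : Paper.H R a d M, x ^ j • z = y := by
    intro j
    induction j with
    | zero => exact ⟨y, by simp⟩
    | succ j ih =>
      obtain ⟨z, hz⟩ := ih
      obtain ⟨w, rfl⟩ := smul_surjective ha (supportDim_eq_dimMod.trans hM).le x z
      exact ⟨w, by rw [pow_succ, mul_smul, hz]⟩
  obtain ⟨z, rfl⟩ := hsurj k
  rw [smul_smul]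
  refine smul_eq_zero ha hM (fun s hs => ?_) z
  by_cases hsq : s = q
  · subst hsq
    exact ⟨u, hu, Ideal.mem_of_dvd _ (mul_dvd_mul_left _ (dvd_mul_left _ _)) huk⟩
  · obtain ⟨u, hu, hug⟩ := hg s hs hsq
    exact ⟨u, hu, Ideal.mem_of_dvd _ (mul_dvd_mul_left _ (dvd_mul_right _ _)) hug⟩

lemma exists_component_ne_zero (ha : a ≤ maximalIdeal R) (hM : Paper.dimMod R M = d)
    {p : Ideal R} (hp : p ∈ Paper.assh R M) {g : R} (hg : g ∉ p)
    (hap : maximalIdeal R ≤ (a ⊔ p).radical) : ∃ y : Paper.H R a d M, g • y ≠ 0 := by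
  by_contra! h0
  let M' := M ⧸ (p • ⊤ : Submodule R M)
  have hMM' : Module.annihilator R M ≤ Module.annihilator R M' :=
    annihilator_le_of_surjective (Submodule.mkQ _) (Submodule.mkQ_surjective _)
  have hpM' : p ≤ Module.annihilator R M' := fun r hr => by
    refine Module.mem_annihilator.2 fun m => ?_
    obtain ⟨m, rfl⟩ := Submodule.mkQ_surjective _ m
    rw [← map_smul, Submodule.mkQ_apply, Submodule.Quotient.mk_eq_zero]
    exact Submodule.smul_mem_smul hr Submodule.mem_top
  have hM'p : Module.annihilator R M' ≤ p := by
    have : (⟨p, hp.1.1⟩ : PrimeSpectrum R) ∈ Module.support R M' := by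
      rw [Module.support_quotient]
      exact ⟨Module.mem_support_iff_of_finite.2 hp.1.2, fun _ h => h⟩
    exact Module.mem_support_iff_of_finite.1 this
  have hM' : Paper.dimMod R M' = d :=
    le_antisymm ((coheight_anti hMM').trans_eq hM)
      ((hp.2.trans hM).symm.le.trans (coheight_anti hM'p))
  refine nontrivial_lc ha d M' (supportDim_eq_dimMod.trans hM')
    (hap.trans (Ideal.radical_mono (sup_le_sup_left hpM' _)))
    (subsingleton_of_forall_eq 0 fun y => ?_)
  obtain ⟨z, rfl⟩ := exists_smul_eq ha hM' (h := g) (fun q hq hgq => by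
    have hqM : q ∈ Paper.assh R M :=
      mem_assh_of_le hM hq.1.1 (hMM'.trans hq.1.2) (hq.2.trans hM').ge
    exact hg ((assh_subset_minimalPrimes hM hqM).2 hp.1 (hpM'.trans hq.1.2) hgq)) y
  obtain ⟨w, rfl⟩ := lcMap_surjective_of_surjective ha (supportDim_eq_dimMod.trans hM).le
    (Submodule.mkQ (p • ⊤ : Submodule R M)) (Submodule.mkQ_surjective _) z
  rw [← map_smul, h0, map_zero]

end Survival

section Parameters
variable {R : Type} [CommRing R] [IsLocalRing R]

lemma exists_mem_maximalIdeal_notMem {P : Set (Ideal R)} (hP : P.Finite)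
    (hprime : ∀ p ∈ P, p.IsPrime) (hm : ∀ p ∈ P, ¬ maximalIdeal R ≤ p) :
    ∃ x ∈ maximalIdeal R, ∀ p ∈ P, x ∉ p := by
  by_contra! h
  obtain ⟨p, hp, hmp⟩ := (Ideal.subset_union_prime_finite hP (f := id)
    0 0 fun p hp _ _ => hprime p hp).1 (fun x hx => Set.mem_iUnion₂.2 (by
      obtain ⟨p, hp, hxp⟩ := h x hx
      exact ⟨p, hp, hxp⟩))
  exact hm p hp hmp

variable [IsNoetherianRing R]

omit [IsNoetherianRing R] in
lemma maximalIdeal_le_of_coheight_le_zero {I p : Ideal R} (hI : Paper.coheight R I ≤ 0)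
    (hp : p.IsPrime) (hIp : I ≤ p) : maximalIdeal R ≤ p := by
  by_contra hmp
  have hlt : (⟨p, hp⟩ : PrimeSpectrum R) < ⟨maximalIdeal R, inferInstance⟩ :=
    lt_of_le_not_ge (le_maximalIdeal hp.ne_top) hmp
  have h : ((1 : ℕ) : WithBot ℕ∞) ≤ Paper.coheight R I := le_coheight_iff.2
    ⟨(RelSeries.singleton _ _).cons _ hlt, by rfl, by exact hIp⟩
  exact absurd (h.trans hI) (by norm_num)

omit [IsLocalRing R] [IsNoetherianRing R] in
lemma add_one_le_of_cast_lt {x : WithBot ℕ∞} {n : ℕ} (h : n < x) : (n + 1 : ℕ) ≤ x := by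
  induction x with
  | bot => simp at h
  | coe x =>
    induction x with
    | top => norm_cast at *; exact le_top
    | coe x => norm_cast at *

omit [IsNoetherianRing R] in
lemma coheight_span_sup_le {I : Ideal R} {e : ℕ} (hI : Paper.coheight R I ≤ (e + 1 : ℕ)) {y : R}
    (hy : ∀ p ∈ I.minimalPrimes, ¬ maximalIdeal R ≤ p → y ∉ p) :
    Paper.coheight R (Ideal.span {y} ⊔ I) ≤ e := by
  by_contra! h
  have h' : ((e + 1 : ℕ) : WithBot ℕ∞) ≤ Paper.coheight R (Ideal.span {y} ⊔ I) :=
    add_one_le_of_cast_lt h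
  obtain ⟨l, hl, hle⟩ := le_coheight_iff.1 h'
  have hlast : l.head < l.last := l.strictMono (Fin.lt_def.2 (by simp [hl]))
  have hlm : ¬ maximalIdeal R ≤ l.head.asIdeal := fun h =>
    hlast.not_ge ((le_maximalIdeal l.last.2.ne_top).trans h)
  have := l.head.2
  obtain ⟨q, hq, hql⟩ := Ideal.exists_minimalPrimes_le (le_sup_right.trans hle)
  have hyl : y ∈ l.head.asIdeal := hle (Ideal.mem_sup_left (Ideal.mem_span_singleton_self y))
  have hyq := hy q hq fun h => hlm (h.trans hql)
  have h2 : ((e + 2 : ℕ) : WithBot ℕ∞) ≤ Paper.coheight R I := le_coheight_iff.2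
    ⟨l.cons ⟨q, hq.1.1⟩ (lt_of_le_not_ge hql fun h => hyq (h hyl) : q < l.head.asIdeal),
      by simp [hl], by simpa using hq.1.2⟩
  exact absurd (Nat.cast_le.1 (h2.trans hI)) (by lia)

/-- A finite family of quotients of dimension at most `e` has a common system of at most `e`
parameters. -/
theorem exists_common_parameters (e : ℕ) : ∀ 𝓘 : Set (Ideal R), 𝓘.Finite →
    (∀ I ∈ 𝓘, Paper.coheight R I ≤ e) →
    ∃ s : Finset R, s.card ≤ e ∧ Ideal.span (s : Set R) ≤ maximalIdeal R ∧
      ∀ I ∈ 𝓘, maximalIdeal R ≤ (Ideal.span (s : Set R) ⊔ I).radical := by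
  classical
  induction e with
  | zero =>
    intro 𝓘 _ h
    refine ⟨∅, le_rfl, by simp, fun I hI => ?_⟩
    rw [Ideal.radical_eq_sInf]
    refine le_sInf fun p hp => maximalIdeal_le_of_coheight_le_zero (by exact_mod_cast h I hI)
      hp.2 (le_sup_right.trans hp.1)
  | succ e ih =>
    intro 𝓘 hfin h
    obtain ⟨y, hym, hy⟩ := exists_mem_maximalIdeal_notMem
      (P := {p ∈ ⋃ I ∈ 𝓘, I.minimalPrimes | ¬ maximalIdeal R ≤ p})
      ((hfin.biUnion fun I _ => Ideal.finite_minimalPrimes_of_isNoetherianRing R I).subset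
        (Set.sep_subset _ _)) (fun p hp => by
          obtain ⟨I, -, hI⟩ := Set.mem_iUnion₂.1 hp.1
          exact hI.1.1) (fun p hp => hp.2)
    obtain ⟨s, hs, hsm, hsI⟩ := ih ((Ideal.span {y} ⊔ ·) '' 𝓘) (hfin.image _) (by
      rintro _ ⟨I, hI, rfl⟩
      exact coheight_span_sup_le (h I hI) fun p hp hmp =>
        hy p ⟨Set.mem_iUnion₂.2 ⟨I, hI, hp⟩, hmp⟩)
    refine ⟨insert y s, (Finset.card_insert_le _ _).trans (by lia), ?_, fun I hI => ?_⟩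
    · rw [Finset.coe_insert, Ideal.span_insert]
      exact sup_le ((Ideal.span_singleton_le_iff_mem _).2 hym) hsm
    · rw [Finset.coe_insert, Ideal.span_insert, sup_comm (Ideal.span {y}), sup_assoc]
      exact hsI _ ⟨I, hI, rfl⟩

end Parameters

section Existence
variable {R : Type} [CommRing R]

lemma attached_eq_empty {F : Type} [AddCommGroup F] [Module R F] [Subsingleton F] :
    Paper.attached R F = ∅ :=
  Set.eq_empty_iff_forall_notMem.2 fun _ ⟨rep, i, _⟩ => (rep.sec i).1 (Subsingleton.elim _ _)

lemma subsingleton_lc_top {i : ℕ} {M : Type} [AddCommGroup M] [Module R M] :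
    Subsingleton (Paper.H R ⊤ i M) := by
  refine subsingleton_of_forall_eq 0 fun y => ?_
  obtain ⟨k, hk⟩ := exists_pow_smul_eq_zero y
  simpa using hk 1 (by rw [Ideal.top_pow]; trivial)

variable [IsNoetherianRing R] [IsLocalRing R]
  {d : ℕ} {M : Type} [AddCommGroup M] [Module R M] [Module.Finite R M]

/-- If an ideal is primary on the primes in `T` and kills the components outside `T`,
the attached primes of top local cohomology are exactly `T`. -/
lemma attached_lc_eq {a : Ideal R} (ha : a ≤ maximalIdeal R) (hM : Paper.dimMod R M = d)
    {T : Set (Ideal R)} (hT : T ⊆ Paper.assh R M)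
    (h1 : ∀ p ∈ T, maximalIdeal R ≤ (a ⊔ p).radical)
    (h2 : ∀ q ∈ Paper.assh R M, q ∉ T →
      ∃ x ∈ q, Subsingleton (Paper.H R a d (QuotSMulTop x M))) :
    Paper.attached R (Paper.H R a d M) = T := by
  have hmin := assh_subset_minimalPrimes hM
  obtain ⟨g, hg⟩ := exists_component_elements
    ((Ideal.finite_minimalPrimes_of_isNoetherianRing R _).subset hmin) hmin
  rw [attached_lc ha hM hg]
  refine Set.Subset.antisymm ?_ fun p hp => ⟨hT hp,
    exists_component_ne_zero ha hM (hT hp) (hg p (hT hp)).1 (h1 p hp)⟩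
  rintro q ⟨hq, y, hy⟩
  by_contra hqT
  obtain ⟨x, hx, _⟩ := h2 q hq hqT
  refine hy (component_eq_zero ha hM hq (fun p hp hpq => ?_) hx y)
  exact (hg q hq).2 p hp hpq

theorem exists_attached_lc_eq (hM : Paper.dimMod R M = d) {T : Set (Ideal R)}
    (hT : T ⊆ Paper.assh R M) : ∃ a : Ideal R, Paper.attached R (Paper.H R a d M) = T := by
  classical
  rcases T.eq_empty_or_nonempty with rfl | ⟨p₀, hp₀⟩
  · have := subsingleton_lc_top (R := R) (i := d) (M := M)
    exact ⟨⊤, attached_eq_empty⟩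
  have hmin := assh_subset_minimalPrimes hM
  have hfin : (Paper.assh R M).Finite :=
    (Ideal.finite_minimalPrimes_of_isNoetherianRing R _).subset hmin
  rcases d with _ | n
  · have hmax : ∀ q ∈ Paper.assh R M, q = maximalIdeal R := fun q hq =>
      le_antisymm (le_maximalIdeal hq.1.1.ne_top)
        (maximalIdeal_le_of_coheight_le_zero (by simpa using (hq.2.trans hM).le) hq.1.1 le_rfl)
    refine ⟨maximalIdeal R, attached_lc_eq le_rfl hM hT
      (fun p _ => le_sup_left.trans Ideal.le_radical) fun q hq hqT => absurd ?_ hqT⟩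
    rwa [hmax q hq, ← hmax p₀ (hT hp₀)]
  obtain ⟨g, hg⟩ := exists_component_elements hfin hmin
  obtain ⟨y, hym, hy⟩ := exists_notMem_minimalPrimes (R := R) (N := M) (by
    rw [supportDim_eq_dimMod, hM]
    exact_mod_cast Nat.succ_le_succ n.zero_le)
  have hTfin := hfin.subset hT
  let x := ∑ p ∈ hTfin.toFinset, y * g p
  have hxm : x ∈ maximalIdeal R := Ideal.sum_mem _ fun p _ => Ideal.mul_mem_right _ _ hym
  have hxT : ∀ p ∈ T, x ∉ p := sum_notMem hTfin (I := Module.annihilator R M)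
    (fun p hp => (hT hp).1.1) (fun p hp => (hT hp).1.2)
    (fun p hp => ⟨(hg p (hT hp)).1, fun q hq => (hg p (hT hp)).2 q (hT hq)⟩)
    (fun p hp => hy p (hmin (hT hp)))
  have hxq : ∀ q ∈ Paper.assh R M, q ∉ T → x ∈ q := fun q hq hqT =>
    Ideal.sum_mem _ fun p hp => by
      have hpT : p ∈ T := by simpa using hp
      obtain ⟨u, hu, hug⟩ := (hg p (hT hpT)).2 q hq fun h => hqT (h ▸ hpT)
      exact Ideal.mul_mem_left _ _ ((hq.1.1.mem_or_mem (hq.1.2 hug)).resolve_left hu)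
  obtain ⟨s, hs, hsm, hsT⟩ := exists_common_parameters n ((Ideal.span {x} ⊔ ·) '' T)
    (hTfin.image _) (by
      rintro _ ⟨p, hp, rfl⟩
      refine coheight_span_sup_le ((hT hp).2.trans hM).le fun q hq _ => ?_
      have := (hT hp).1.1
      rw [Ideal.minimalPrimes_eq_subsingleton_self] at hq
      exact hq ▸ hxT p hp)
  have hspan : Ideal.span ((insert x s : Finset R) : Set R) =
      Ideal.span (s : Set R) ⊔ Ideal.span {x} := by
    rw [Finset.coe_insert, Ideal.span_insert, sup_comm]
  have hxm' : Ideal.span {x} ≤ maximalIdeal R := (Ideal.span_singleton_le_iff_mem _).2 hxm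
  refine ⟨Ideal.span (s : Set R) ⊔ Ideal.span {x}, attached_lc_eq (sup_le hsm hxm') hM hT
    (fun p hp => ?_) fun q hq hqT => ⟨x, hxq q hq hqT, ?_⟩⟩
  · rw [sup_assoc]
    exact hsT _ ⟨p, hp, rfl⟩
  · refine subsingleton_of_card_lt n s hs le_sup_left _ _ ((sup_le_sup_left ?_ _).trans
      Ideal.le_radical) n.lt_succ_self
    exact (Ideal.span_singleton_le_iff_mem _).2 (mem_annihilator_quotSMulTop x)

end Existence

end

end LC

/-- Over a complete Noetherian local ring, every subset of `Assh M` is the set of attached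
primes of the top local cohomology `H^d_a(M)` for some ideal `a`. -/
theorem exists_ideal_attached_top_eq (R : Type) [CommRing R] [IsNoetherianRing R]
    [IsLocalRing R] [IsAdicComplete (IsLocalRing.maximalIdeal R) R]
    (M : Type) [AddCommGroup M] [Module R M] [Module.Finite R M]
    (d : ℕ) (hdim : Paper.dimMod R M = d)
    (T : Set (Ideal R)) (hT : T ⊆ Paper.assh R M) :
    ∃ a : Ideal R, Paper.attached R (Paper.H R a d M) = T :=
  LC.exists_attached_lc_eq hdim hT
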